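/- arXiv:2405.11291 — 3 statements merged into one kernel-verified Lean document; each statement's English description precedes it below -/
import Mathlib

section
/- η̄(r) < ∞ for every r > 0 if and only if both ∫_{(0,1]} z^{1+α/d} λ(dz) < ∞ and ∫_{(1,∞)} z^{d/(d+α)} λ(dz) < ∞. -/
open MeasureTheory Set Filter Topology
open scoped ENNReal NNReal

/-- The heat-kernel profile `p_s(y) = s^{-d/α} g(|y|/s^{1/α})`. -/
noncomputable def pker (d : ℕ) (α : ℝ) (g : ℝ → ℝ) (s : ℝ)
    (y : EuclideanSpace ℝ (Fin d)) : ℝ :=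
  s ^ (-((d : ℝ) / α)) * g (‖y‖ / s ^ ((1 : ℝ) / α))

/-- `etaBar d α t g lam r = η̄(r)`, where
`η(B) = (Leb_(0,t] ⊗ Leb_{ℝ^d} ⊗ λ)({(s,y,z) : p_s(y)·z ∈ B})` and `η̄(r) = η((r,∞))`. -/
noncomputable def etaBar (d : ℕ) (α t : ℝ) (g : ℝ → ℝ) (lam : MeasureTheory.Measure ℝ)
    (r : ℝ) : ℝ≥0∞ :=
  ((MeasureTheory.volume.restrict (Set.Ioc (0:ℝ) t)).prod
      ((MeasureTheory.volume : MeasureTheory.Measure (EuclideanSpace ℝ (Fin d))).prod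
        (lam.restrict (Set.Ioi (0:ℝ)))))
    {q : ℝ × EuclideanSpace ℝ (Fin d) × ℝ | r < pker d α g q.1 q.2.1 * q.2.2}

/-- The profile `g` is bounded above and below by multiples of `min 1 (x ^ (-q))`. -/
theorem exists_profile_bounds {g : ℝ → ℝ} {q c₀ : ℝ} (hq : 0 < q)
    (hg_anti : StrictAntiOn g (Ici 0)) (hg_pos : ∀ x : ℝ, 0 ≤ x → 0 < g x) (hc₀ : 0 < c₀)
    (hg_tail : Tendsto (fun r : ℝ => r ^ q * g r) atTop (𝓝 c₀)) :
    ∃ c C : ℝ, 0 < c ∧ 0 < C ∧ (∀ x, 0 ≤ x → c < g x ∨ c < x ^ q * g x) ∧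
      ∀ x, 0 ≤ x → g x ≤ C ∧ x ^ q * g x ≤ C := by
  have h1 : ∀ᶠ x in atTop, c₀ / 2 < x ^ q * g x := hg_tail.eventually (lt_mem_nhds (by linarith))
  have h2 : ∀ᶠ x in atTop, x ^ q * g x < 2 * c₀ := hg_tail.eventually (gt_mem_nhds (by linarith))
  obtain ⟨R, hR⟩ := eventually_atTop.1 ((h1.and h2).and (eventually_ge_atTop 0))
  have hR0 : 0 ≤ R := (hR R le_rfl).2
  have hg0 := hg_pos 0 le_rfl
  have hgR := hg_pos R hR0
  have hg_le : ∀ x, 0 ≤ x → g x ≤ g 0 := fun x hx =>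
    hg_anti.antitoneOn self_mem_Ici hx hx
  refine ⟨min (c₀ / 2) (g R / 2), max (g 0) (max (2 * c₀) (R ^ q * g 0)),
    by positivity, by positivity, fun x hx => ?_, fun x hx => ⟨?_, ?_⟩⟩
  · rcases le_total R x with h | h
    · exact Or.inr ((min_le_left _ _).trans_lt (hR x h).1.1)
    · have := hg_anti.antitoneOn (mem_Ici.2 hx) (mem_Ici.2 hR0) h
      exact Or.inl ((min_le_right _ _).trans_lt (by linarith))
  · exact (hg_le x hx).trans (le_max_left _ _)
  · rcases le_total R x with h | h
    · exact (hR x h).1.2.le.trans ((le_max_left _ _).trans (le_max_right _ _))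
    · refine le_trans ?_ ((le_max_right _ _).trans (le_max_right _ _))
      exact mul_le_mul (Real.rpow_le_rpow hx h hq.le) (hg_le x hx) (hg_pos x hx).le
        (Real.rpow_nonneg hR0 _)

/-- The region `s ^ (d / α) ≤ K z`, `‖y‖ ^ (d + α) < K s z`, solved for `s` and `‖y‖`. -/
def modelRegion (d : ℕ) (α K : ℝ) : Set (ℝ × EuclideanSpace ℝ (Fin d) × ℝ) :=
  {q | q.1 ≤ (K * q.2.2) ^ (α / d) ∧ ‖q.2.1‖ < (K * q.1 * q.2.2) ^ ((d : ℝ) + α)⁻¹}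

theorem mem_modelRegion_iff {d : ℕ} (hd : 1 ≤ d) {α K s z : ℝ} (hα : 0 < α) (hK : 0 < K)
    (hs : 0 < s) (hz : 0 < z) (y : EuclideanSpace ℝ (Fin d)) :
    (s, y, z) ∈ modelRegion d α K ↔
      s ^ ((d : ℝ) / α) ≤ K * z ∧ ‖y‖ ^ ((d : ℝ) + α) < K * s * z := by
  have hd' : (0 : ℝ) < d := by exact_mod_cast hd
  have h := Real.le_rpow_inv_iff_of_pos hs.le (by positivity : 0 ≤ K * z)
    (by positivity : 0 < (d : ℝ) / α)
  rw [inv_div] at h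
  exact and_congr h (Real.lt_rpow_inv_iff_of_pos (norm_nonneg y) (by positivity) (by positivity))

theorem div_rpow_heat_scale {d : ℕ} {α s u : ℝ} (hα : 0 < α) (hs : 0 < s) (hu : 0 ≤ u) :
    (u / s ^ (1 / α)) ^ ((d : ℝ) + α) * (s ^ ((d : ℝ) / α) * s) = u ^ ((d : ℝ) + α) := by
  have h : s ^ ((d : ℝ) / α) * s = (s ^ (1 / α)) ^ ((d : ℝ) + α) := by
    rw [← Real.rpow_mul hs.le, ← Real.rpow_add_one hs.ne']
    congr 1
    field_simp
  rw [h, ← Real.mul_rpow (by positivity) (by positivity), div_mul_cancel₀ _ (by positivity)]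

theorem lt_pker_mul_iff {d : ℕ} {α r s z : ℝ} {g : ℝ → ℝ} (hs : 0 < s)
    (y : EuclideanSpace ℝ (Fin d)) :
    r < pker d α g s y * z ↔ r * s ^ ((d : ℝ) / α) < g (‖y‖ / s ^ (1 / α)) * z := by
  have : 0 < s ^ ((d : ℝ) / α) := by positivity
  rw [pker, Real.rpow_neg hs.le, mul_assoc, inv_mul_eq_div, lt_div_iff₀ this]

theorem lt_pker_mul_of_mem_modelRegion {d : ℕ} (hd : 1 ≤ d) {α c r s z : ℝ} {g : ℝ → ℝ}
    (hα : 0 < α) (hc : 0 < c) (hr : 0 < r) (hs : 0 < s) (hz : 0 < z)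
    (hg_pos : ∀ x : ℝ, 0 ≤ x → 0 < g x)
    (hg : ∀ x, 0 ≤ x → c < g x ∨ c < x ^ ((d : ℝ) + α) * g x)
    (y : EuclideanSpace ℝ (Fin d)) (h : (s, y, z) ∈ modelRegion d α (c / r)) :
    r < pker d α g s y * z := by
  rw [mem_modelRegion_iff hd hα (by positivity) hs hz] at h
  rw [lt_pker_mul_iff hs]
  have hx : 0 ≤ ‖y‖ / s ^ (1 / α) := by positivity
  have hscale := div_rpow_heat_scale (d := d) hα hs (norm_nonneg y)
  set x := ‖y‖ / s ^ (1 / α)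
  set a := s ^ ((d : ℝ) / α)
  have ha : 0 < a := by positivity
  have h1 : r * a ≤ c * z := by
    have := mul_le_mul_of_nonneg_left h.1 hr.le
    rwa [show r * (c / r * z) = c * z by field_simp] at this
  have h2 : r * ‖y‖ ^ ((d : ℝ) + α) < c * s * z := by
    have := mul_lt_mul_of_pos_left h.2 hr
    rwa [show r * (c / r * s * z) = c * s * z by field_simp] at this
  rcases hg x hx with hgx | hgx
  · exact h1.trans_lt (mul_lt_mul_of_pos_right hgx hz)
  · refine lt_of_mul_lt_mul_left (a := c * s) ?_ (by positivity)
    calc c * s * (r * a) = c * (r * (a * s)) := by ring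
      _ < x ^ ((d : ℝ) + α) * g x * (r * (a * s)) := mul_lt_mul_of_pos_right hgx (by positivity)
      _ = r * ‖y‖ ^ ((d : ℝ) + α) * g x := by rw [← hscale]; ring
      _ ≤ c * s * z * g x := mul_le_mul_of_nonneg_right h2.le (hg_pos x hx).le
      _ = c * s * (g x * z) := by ring

theorem mem_modelRegion_of_lt_pker_mul {d : ℕ} (hd : 1 ≤ d) {α C r s z : ℝ} {g : ℝ → ℝ}
    (hα : 0 < α) (hC : 0 < C) (hr : 0 < r) (hs : 0 < s) (hz : 0 < z)
    (hg : ∀ x, 0 ≤ x → g x ≤ C ∧ x ^ ((d : ℝ) + α) * g x ≤ C)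
    (y : EuclideanSpace ℝ (Fin d)) (h : r < pker d α g s y * z) :
    (s, y, z) ∈ modelRegion d α (C / r) := by
  rw [mem_modelRegion_iff hd hα (by positivity) hs hz]
  rw [lt_pker_mul_iff hs] at h
  have hx : 0 ≤ ‖y‖ / s ^ (1 / α) := by positivity
  have hscale := div_rpow_heat_scale (d := d) hα hs (norm_nonneg y)
  set x := ‖y‖ / s ^ (1 / α)
  set a := s ^ ((d : ℝ) / α)
  have ha : 0 < a := by positivity
  constructor
  · refine le_of_mul_le_mul_left ?_ hr
    calc r * a ≤ g x * z := h.le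
      _ ≤ C * z := mul_le_mul_of_nonneg_right (hg x hx).1 hz.le
      _ = r * (C / r * z) := by field_simp
  · rcases (Real.rpow_nonneg hx ((d : ℝ) + α)).eq_or_lt with h0 | h0
    · rw [← hscale, ← h0, zero_mul]
      positivity
    · refine lt_of_mul_lt_mul_left (a := r) ?_ hr.le
      calc r * ‖y‖ ^ ((d : ℝ) + α) = x ^ ((d : ℝ) + α) * s * (r * a) := by rw [← hscale]; ring
        _ < x ^ ((d : ℝ) + α) * s * (g x * z) := mul_lt_mul_of_pos_left h (by positivity)
        _ = x ^ ((d : ℝ) + α) * g x * (s * z) := by ring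
        _ ≤ C * (s * z) := mul_le_mul_of_nonneg_right (hg x hx).2 (by positivity)
        _ = r * (C / r * s * z) := by field_simp

/-- The measure `Leb_(0,t] ⊗ Leb_{ℝ^d} ⊗ λ` on space, time and jump size. -/
noncomputable def jumpMeasure (d : ℕ) (t : ℝ) (lam : Measure ℝ) :
    Measure (ℝ × EuclideanSpace ℝ (Fin d) × ℝ) :=
  (volume.restrict (Ioc (0 : ℝ) t)).prod
    ((volume : Measure (EuclideanSpace ℝ (Fin d))).prod (lam.restrict (Ioi (0 : ℝ))))

theorem ae_jumpMeasure_pos (d : ℕ) (t : ℝ) (lam : Measure ℝ) [SigmaFinite lam] :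
    ∀ᵐ q ∂jumpMeasure d t lam, 0 < q.1 ∧ 0 < q.2.2 := by
  have h1 : ∀ᵐ s ∂volume.restrict (Ioc (0 : ℝ) t), 0 < s :=
    (ae_restrict_mem measurableSet_Ioc).mono fun s hs => hs.1
  have h2 : ∀ᵐ z ∂lam.restrict (Ioi (0 : ℝ)), 0 < z := ae_restrict_mem measurableSet_Ioi
  exact (Measure.quasiMeasurePreserving_fst.ae h1).and
    (Measure.quasiMeasurePreserving_snd.ae (Measure.quasiMeasurePreserving_snd.ae h2))

theorem measurableSet_modelRegion (d : ℕ) (α K : ℝ) : MeasurableSet (modelRegion d α K) := by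
  rw [modelRegion, ofPred_and]
  exact (measurableSet_le (by fun_prop) (by fun_prop)).inter
    (measurableSet_lt (by fun_prop) (by fun_prop))

theorem setLIntegral_Ioc_rpow {p M : ℝ} (hp : 0 ≤ p) (hM : 0 ≤ M) :
    ∫⁻ s in Ioc 0 M, ENNReal.ofReal (s ^ p) = ENNReal.ofReal (M ^ (p + 1) / (p + 1)) := by
  have hint : IntervalIntegrable (fun s : ℝ => s ^ p) volume 0 M :=
    intervalIntegral.intervalIntegrable_rpow (Or.inl hp)
  rw [intervalIntegrable_iff_integrableOn_Ioc_of_le hM] at hint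
  rw [← ofReal_integral_eq_lintegral_ofReal hint
    ((ae_restrict_mem measurableSet_Ioc).mono fun s hs => Real.rpow_nonneg hs.1.le _),
    ← intervalIntegral.integral_of_le hM, integral_rpow (Or.inl (by linarith)),
    Real.zero_rpow (by linarith), sub_zero]

theorem jumpMeasure_modelRegion {d : ℕ} (hd : 1 ≤ d) {α K t : ℝ} (hα : 0 < α) (hK : 0 < K)
    (ht : 0 < t) (lam : Measure ℝ) [SigmaFinite lam] :
    jumpMeasure d t lam (modelRegion d α K) =
      (ENNReal.ofReal ((d : ℝ) / (d + α) + 1)⁻¹ *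
          volume (Metric.ball (0 : EuclideanSpace ℝ (Fin d)) 1)) *
        ∫⁻ z in Ioi (0 : ℝ), ENNReal.ofReal ((K * z) ^ ((d : ℝ) / (d + α)) *
          (min t ((K * z) ^ (α / d))) ^ ((d : ℝ) / (d + α) + 1)) ∂lam := by
  have hd' : (0 : ℝ) < d := by exact_mod_cast hd
  have : Nonempty (Fin d) := ⟨⟨0, hd⟩⟩
  set p := (d : ℝ) / (d + α) with hp
  have hp0 : 0 < p := by positivity
  set ω := volume (Metric.ball (0 : EuclideanSpace ℝ (Fin d)) 1)
  have hball : ∀ u : ℝ, volume (Metric.ball (0 : EuclideanSpace ℝ (Fin d)) u) =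
      ENNReal.ofReal u ^ d * ω := by
    intro u
    simp only [ω, EuclideanSpace.volume_ball, Fintype.card_fin]
    simp
  have hsec : ∀ s z : ℝ, volume ((fun y : EuclideanSpace ℝ (Fin d) => (y, z)) ⁻¹'
      (Prod.mk s ⁻¹' modelRegion d α K)) =
      {x : ℝ × ℝ | x.1 ≤ (K * x.2) ^ (α / d)}.indicator
        (fun x => ENNReal.ofReal ((K * x.1 * x.2) ^ ((d : ℝ) + α)⁻¹) ^ d * ω) (s, z) := by
    intro s z
    by_cases h : s ≤ (K * z) ^ (α / d)
    · rw [indicator_of_mem (show (s, z) ∈ {x : ℝ × ℝ | x.1 ≤ (K * x.2) ^ (α / d)} from h), ← hball]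
      congr 1
      ext y
      simp [modelRegion, h]
    · rw [indicator_of_notMem (show (s, z) ∉ {x : ℝ × ℝ | x.1 ≤ (K * x.2) ^ (α / d)} from h)]
      convert measure_empty (μ := volume)
      ext y
      simp [modelRegion, h]
  have hE := measurableSet_modelRegion d α K
  rw [jumpMeasure, Measure.prod_apply hE]
  simp_rw [fun s : ℝ => Measure.prod_apply_symm
    (μ := (volume : Measure (EuclideanSpace ℝ (Fin d)))) (ν := lam.restrict (Ioi (0 : ℝ)))
    (measurable_prodMk_left (x := s) hE), hsec]
  rw [lintegral_lintegral_swap, ← lintegral_const_mul]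
  rotate_left
  · fun_prop
  · refine (Measurable.indicator (by fun_prop)
      (measurableSet_le (by fun_prop) (by fun_prop))).aemeasurable
  refine setLIntegral_congr_fun measurableSet_Ioi fun z hz => ?_
  have hz : 0 < z := hz
  have hM : 0 ≤ min t ((K * z) ^ (α / d)) := by positivity
  have hset : ∀ s : ℝ, {x : ℝ × ℝ | x.1 ≤ (K * x.2) ^ (α / d)}.indicator
      (fun x => ENNReal.ofReal ((K * x.1 * x.2) ^ ((d : ℝ) + α)⁻¹) ^ d * ω) (s, z) =
      (Iic ((K * z) ^ (α / d))).indicator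
        (fun s => ENNReal.ofReal ((K * s * z) ^ ((d : ℝ) + α)⁻¹) ^ d * ω) s := fun s => rfl
  simp_rw [hset]
  rw [lintegral_indicator measurableSet_Iic, Measure.restrict_restrict measurableSet_Iic,
    inter_comm, Ioc_inter_Iic]
  have hcongr : ∀ s ∈ Ioc 0 (min t ((K * z) ^ (α / d))),
      ENNReal.ofReal ((K * s * z) ^ ((d : ℝ) + α)⁻¹) ^ d * ω =
      (ENNReal.ofReal ((K * z) ^ p) * ω) * ENNReal.ofReal (s ^ p) := by
    intro s hs
    have hs0 : 0 < s := hs.1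
    rw [← ENNReal.ofReal_pow (by positivity), ← Real.rpow_natCast, ← Real.rpow_mul (by positivity),
      show ((d : ℝ) + α)⁻¹ * d = p by rw [hp]; ring, show K * s * z = K * z * s by ring,
      Real.mul_rpow (by positivity) hs0.le, ENNReal.ofReal_mul (by positivity)]
    ring
  rw [setLIntegral_congr_fun measurableSet_Ioc hcongr, lintegral_const_mul _ (by fun_prop),
    setLIntegral_Ioc_rpow hp0.le hM, div_eq_mul_inv, ENNReal.ofReal_mul (by positivity),
    ENNReal.ofReal_mul (by positivity)]
  ring

theorem setLIntegral_lt_top_of_le_mul {lam : Measure ℝ} {S : Set ℝ} {f h : ℝ → ℝ} {A : ℝ}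
    (hS : MeasurableSet S) (hA : 0 ≤ A) (hle : ∀ z ∈ S, f z ≤ A * h z)
    (hfin : ∫⁻ z in S, ENNReal.ofReal (h z) ∂lam < ⊤) :
    ∫⁻ z in S, ENNReal.ofReal (f z) ∂lam < ⊤ := by
  calc ∫⁻ z in S, ENNReal.ofReal (f z) ∂lam
      ≤ ∫⁻ z in S, ENNReal.ofReal A * ENNReal.ofReal (h z) ∂lam :=
        setLIntegral_mono' hS fun z hz => by
          rw [← ENNReal.ofReal_mul hA]
          exact ENNReal.ofReal_le_ofReal (hle z hz)
    _ = ENNReal.ofReal A * ∫⁻ z in S, ENNReal.ofReal (h z) ∂lam :=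
        lintegral_const_mul' _ _ ENNReal.ofReal_ne_top
    _ < ⊤ := ENNReal.mul_lt_top ENNReal.ofReal_lt_top hfin

theorem jumpMeasure_modelRegion_lt_top_iff {d : ℕ} (hd : 1 ≤ d) {α K t : ℝ} (hα : 0 < α)
    (hK : 0 < K) (ht : 0 < t) (lam : Measure ℝ) [SigmaFinite lam] :
    jumpMeasure d t lam (modelRegion d α K) < ⊤ ↔
      (∫⁻ z in Ioc (0 : ℝ) 1, ENNReal.ofReal (z ^ (1 + α / (d : ℝ))) ∂lam < ⊤ ∧
        ∫⁻ z in Ioi (1 : ℝ), ENNReal.ofReal (z ^ ((d : ℝ) / ((d : ℝ) + α))) ∂lam < ⊤) := by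
  have hd' : (0 : ℝ) < d := by exact_mod_cast hd
  have hexp : ∀ u : ℝ, 0 < u → u ^ (1 + α / (d : ℝ)) =
      u ^ ((d : ℝ) / (d + α)) * (u ^ (α / d)) ^ ((d : ℝ) / (d + α) + 1) := by
    intro u hu
    rw [← Real.rpow_mul hu.le, ← Real.rpow_add hu]
    congr 1
    field_simp
    ring
  set p := (d : ℝ) / (d + α)
  have hp0 : 0 < p := by positivity
  rw [jumpMeasure_modelRegion hd hα hK ht, ENNReal.mul_lt_top_iff]
  have hω : 0 < volume (Metric.ball (0 : EuclideanSpace ℝ (Fin d)) 1) :=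
    Metric.measure_ball_pos _ _ one_pos
  have hκ0 : ENNReal.ofReal (p + 1)⁻¹ *
      volume (Metric.ball (0 : EuclideanSpace ℝ (Fin d)) 1) ≠ 0 :=
    mul_ne_zero (ENNReal.ofReal_pos.2 (by positivity)).ne' hω.ne'
  have hκ : ENNReal.ofReal (p + 1)⁻¹ *
      volume (Metric.ball (0 : EuclideanSpace ℝ (Fin d)) 1) < ⊤ :=
    ENNReal.mul_lt_top ENNReal.ofReal_lt_top measure_ball_lt_top
  set F : ℝ → ℝ := fun z => (K * z) ^ p * (min t ((K * z) ^ (α / d))) ^ (p + 1)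
  have hF : ∫⁻ z in Ioi (0 : ℝ), ENNReal.ofReal (F z) ∂lam =
      ∫⁻ z in Ioc (0 : ℝ) 1, ENNReal.ofReal (F z) ∂lam +
        ∫⁻ z in Ioi (1 : ℝ), ENNReal.ofReal (F z) ∂lam := by
    rw [← lintegral_union measurableSet_Ioi (Ioc_disjoint_Ioi le_rfl),
      Ioc_union_Ioi_eq_Ioi zero_le_one]
  set m := min t (K ^ (α / d))
  have hm : 0 < m := by positivity
  have hlow : 0 < K ^ p * m ^ (p + 1) := by positivity
  have hsmall_low : ∀ z ∈ Ioc (0 : ℝ) 1,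
      z ^ (1 + α / (d : ℝ)) ≤ (K ^ p * m ^ (p + 1))⁻¹ * F z := by
    rintro z ⟨hz, hz1⟩
    rw [inv_mul_eq_div, le_div_iff₀ hlow, hexp z hz]
    have hz2 : z ^ (α / d) ≤ 1 := Real.rpow_le_one hz.le hz1 (by positivity)
    have : z ^ (α / d) * m ≤ min t ((K * z) ^ (α / d)) := by
      refine le_min ?_ ?_
      · exact (mul_le_of_le_one_left hm.le hz2).trans (min_le_left _ _)
      · rw [Real.mul_rpow hK.le hz.le, mul_comm]
        exact mul_le_mul_of_nonneg_right (min_le_right _ _) (by positivity)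
    calc z ^ p * (z ^ (α / d)) ^ (p + 1) * (K ^ p * m ^ (p + 1))
        = (K * z) ^ p * (z ^ (α / d) * m) ^ (p + 1) := by
          rw [Real.mul_rpow hK.le hz.le, Real.mul_rpow (by positivity) hm.le]; ring
      _ ≤ F z := mul_le_mul_of_nonneg_left
          (Real.rpow_le_rpow (by positivity) this (by positivity)) (by positivity)
  have hlarge_low : ∀ z ∈ Ioi (1 : ℝ), z ^ p ≤ (K ^ p * m ^ (p + 1))⁻¹ * F z := by
    intro z hz1
    have hz1 : 1 < z := hz1
    have hz : 0 < z := by linarith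
    rw [inv_mul_eq_div, le_div_iff₀ hlow]
    have : m ≤ min t ((K * z) ^ (α / d)) :=
      min_le_min le_rfl (Real.rpow_le_rpow hK.le (by nlinarith) (by positivity))
    calc z ^ p * (K ^ p * m ^ (p + 1)) = (K * z) ^ p * m ^ (p + 1) := by
          rw [Real.mul_rpow hK.le hz.le]; ring
      _ ≤ F z := mul_le_mul_of_nonneg_left
          (Real.rpow_le_rpow (by positivity) this (by positivity)) (by positivity)
  have hsmall_up : ∀ z ∈ Ioc (0 : ℝ) 1, F z ≤ K ^ (1 + α / (d : ℝ)) * z ^ (1 + α / (d : ℝ)) := by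
    rintro z ⟨hz, -⟩
    rw [← Real.mul_rpow hK.le hz.le, hexp _ (by positivity)]
    exact mul_le_mul_of_nonneg_left (Real.rpow_le_rpow (by positivity) (min_le_right _ _)
      (by positivity)) (by positivity)
  have hlarge_up : ∀ z ∈ Ioi (1 : ℝ), F z ≤ K ^ p * t ^ (p + 1) * z ^ p := by
    intro z hz1
    have hz : 0 < z := one_pos.trans hz1
    calc F z ≤ (K * z) ^ p * t ^ (p + 1) := mul_le_mul_of_nonneg_left
          (Real.rpow_le_rpow (by positivity) (min_le_left _ _) (by positivity)) (by positivity)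
      _ = K ^ p * t ^ (p + 1) * z ^ p := by rw [Real.mul_rpow hK.le hz.le]; ring
  constructor
  · intro h
    have hfin : ∫⁻ z in Ioi (0 : ℝ), ENNReal.ofReal (F z) ∂lam < ⊤ := by
      rcases h with ⟨-, h⟩ | h | h
      · exact h
      · exact absurd h hκ0
      · exact h.trans_lt ENNReal.zero_lt_top
    rw [hF, ENNReal.add_lt_top] at hfin
    exact ⟨setLIntegral_lt_top_of_le_mul measurableSet_Ioc (by positivity) hsmall_low hfin.1,
      setLIntegral_lt_top_of_le_mul measurableSet_Ioi (by positivity) hlarge_low hfin.2⟩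
  · rintro ⟨h1, h2⟩
    refine Or.inl ⟨hκ, ?_⟩
    rw [hF, ENNReal.add_lt_top]
    exact ⟨setLIntegral_lt_top_of_le_mul measurableSet_Ioc (by positivity) hsmall_up h1,
      setLIntegral_lt_top_of_le_mul measurableSet_Ioi (by positivity) hlarge_up h2⟩

theorem stmt5 (d : ℕ) (hd : 1 ≤ d) (α : ℝ) (hα : α ∈ Set.Ioo (0:ℝ) 2) (t : ℝ) (ht : 0 < t)
    (lam : MeasureTheory.Measure ℝ) [SigmaFinite lam]
    (hlam0 : lam (Set.Iic 0) = 0) (hlam_ne : lam ≠ 0)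
    (hmom : ∫⁻ z in Set.Ioi (0:ℝ), ENNReal.ofReal (min 1 (z ^ 2)) ∂lam ≠ ⊤)
    (g : ℝ → ℝ) (hg_cont : ContinuousOn g (Set.Ici 0))
    (hg_anti : StrictAntiOn g (Set.Ici 0)) (hg_pos : ∀ x : ℝ, 0 ≤ x → 0 < g x)
    (c₀ : ℝ) (hc₀ : 0 < c₀)
    (hg_tail : Filter.Tendsto (fun r : ℝ => r ^ ((d:ℝ) + α) * g r) Filter.atTop (nhds c₀)) :
    (∀ r : ℝ, 0 < r → etaBar d α t g lam r < ⊤) ↔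
      (∫⁻ z in Set.Ioc (0:ℝ) 1, ENNReal.ofReal (z ^ (1 + α / (d:ℝ))) ∂lam < ⊤ ∧
        ∫⁻ z in Set.Ioi (1:ℝ), ENNReal.ofReal (z ^ ((d:ℝ) / ((d:ℝ) + α))) ∂lam < ⊤) := by
  have hα0 : 0 < α := hα.1
  have hq : 0 < (d : ℝ) + α := by positivity
  obtain ⟨c, C, hc, hC, hlow, hup⟩ := exists_profile_bounds hq hg_anti hg_pos hc₀ hg_tail
  constructor
  · intro h
    rw [← jumpMeasure_modelRegion_lt_top_iff hd hα0 (div_pos hc one_pos) ht]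
    refine lt_of_le_of_lt (measure_mono_ae ?_) (h 1 one_pos)
    filter_upwards [ae_jumpMeasure_pos d t lam] with q hq hmem
    exact lt_pker_mul_of_mem_modelRegion hd hα0 hc one_pos hq.1 hq.2 hg_pos hlow q.2.1 hmem
  · intro h r hr
    rw [← jumpMeasure_modelRegion_lt_top_iff hd hα0 (div_pos hC hr) ht] at h
    refine lt_of_le_of_lt (measure_mono_ae ?_) h
    filter_upwards [ae_jumpMeasure_pos d t lam] with q hq hmem
    exact mem_modelRegion_of_lt_pker_mul hd hα0 hC hr hq.1 hq.2 hup q.2.1 hmem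
end

section
/- Assume ∫_{(0,1]} z^{1+α/d} λ(dz) < ∞ and ∫_{(1,∞)} z^{d/(d+α)} λ(dz) < ∞. Then r ↦ η̄(r) is continuous and nonincreasing on (0,∞), satisfies liminf_{r→∞} r^{1+α/d} η̄(r) > 0, and is of extended regular variation at infinity. -/
open MeasureTheory Set Filter Topology
open scoped ENNReal NNReal

/-- `f : (0,∞) → (0,∞)` is of extended regular variation at infinity: there are `δ₁, δ₂ ≥ 0`
such that for every `c ≥ 1`,
`c^{-δ₁} ≤ liminf_{s→∞} f(cs)/f(s) ≤ limsup_{s→∞} f(cs)/f(s) ≤ c^{δ₂}`. -/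
def ExtendedRegularVariation (f : ℝ → ℝ) : Prop :=
  ∃ δ₁ δ₂ : ℝ, 0 ≤ δ₁ ∧ 0 ≤ δ₂ ∧ ∀ c : ℝ, 1 ≤ c →
    c ^ (-δ₁) ≤ Filter.liminf (fun s => f (c * s) / f s) Filter.atTop ∧
    Filter.liminf (fun s => f (c * s) / f s) Filter.atTop ≤
      Filter.limsup (fun s => f (c * s) / f s) Filter.atTop ∧
    Filter.limsup (fun s => f (c * s) / f s) Filter.atTop ≤ c ^ δ₂

theorem measurable_pker {d : ℕ} {α : ℝ} {g : ℝ → ℝ} (hg : Continuous g) :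
    Measurable fun q : ℝ × EuclideanSpace ℝ (Fin d) × ℝ => pker d α g q.1 q.2.1 * q.2.2 := by
  unfold pker
  have := hg.measurable
  fun_prop

theorem measurableSet_lt_pker {d : ℕ} {α : ℝ} {g : ℝ → ℝ} (hg : Continuous g) (r : ℝ) :
    MeasurableSet {q : ℝ × EuclideanSpace ℝ (Fin d) × ℝ | r < pker d α g q.1 q.2.1 * q.2.2} :=
  measurableSet_lt measurable_const (measurable_pker hg)

/-- The measure whose image under `(s, y, z) ↦ p_s(y) z` is `η`. -/
noncomputable def sourceMeasure (d : ℕ) (t : ℝ) (lam : Measure ℝ) :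
    Measure (ℝ × EuclideanSpace ℝ (Fin d) × ℝ) :=
  (volume.restrict (Ioc (0:ℝ) t)).prod
    ((volume : Measure (EuclideanSpace ℝ (Fin d))).prod (lam.restrict (Ioi (0:ℝ))))

theorem ae_sourceMeasure (d : ℕ) (t : ℝ) (lam : Measure ℝ) [SigmaFinite lam] :
    ∀ᵐ q ∂sourceMeasure d t lam, 0 < q.1 ∧ 0 < q.2.2 := by
  have h1 : ∀ᵐ s ∂(volume.restrict (Ioc (0:ℝ) t)), 0 < s := by
    filter_upwards [ae_restrict_mem measurableSet_Ioc] with s hs using hs.1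
  have h2 : ∀ᵐ z ∂(lam.restrict (Ioi (0:ℝ))), 0 < z := by
    filter_upwards [ae_restrict_mem measurableSet_Ioi] with s hs using hs
  have h3 : ∀ᵐ q ∂sourceMeasure d t lam, 0 < q.1 :=
    Measure.quasiMeasurePreserving_fst.ae h1
  have h4 : ∀ᵐ q ∂sourceMeasure d t lam, 0 < q.2.2 :=
    (Measure.quasiMeasurePreserving_snd.comp Measure.quasiMeasurePreserving_snd).ae h2
  filter_upwards [h3, h4] with q a b using ⟨a, b⟩

theorem etaBar_congr {d : ℕ} {α t : ℝ} {g g' : ℝ → ℝ} {lam : Measure ℝ} [SigmaFinite lam]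
    (h : ∀ x, 0 ≤ x → g x = g' x) : etaBar d α t g lam = etaBar d α t g' lam := by
  funext r
  refine measure_congr ?_
  filter_upwards [ae_sourceMeasure d t lam] with q hq
  have := hq.1
  have h0 : 0 ≤ ‖q.2.1‖ / q.1 ^ ((1:ℝ) / α) := by positivity
  have : pker d α g q.1 q.2.1 = pker d α g' q.1 q.2.1 := by
    unfold pker
    rw [h _ h0]
  change (r < pker d α g q.1 q.2.1 * q.2.2) = (r < pker d α g' q.1 q.2.1 * q.2.2)
  rw [this]

theorem etaBar_eq_lintegral {d : ℕ} {α t : ℝ} {g : ℝ → ℝ} {lam : Measure ℝ} [SigmaFinite lam]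
    (hg : Continuous g) (r : ℝ) :
    etaBar d α t g lam r = ∫⁻ s in Ioc (0:ℝ) t, ∫⁻ z in Ioi (0:ℝ),
      volume {y : EuclideanSpace ℝ (Fin d) | r < pker d α g s y * z} ∂lam := by
  unfold etaBar
  rw [Measure.prod_apply (measurableSet_lt_pker hg r)]
  refine lintegral_congr fun s => ?_
  rw [Measure.prod_apply_symm (measurable_prodMk_left (measurableSet_lt_pker hg r))]
  rfl

theorem etaBar_antitone {d : ℕ} {α t : ℝ} {g : ℝ → ℝ} {lam : Measure ℝ} :
    Antitone (etaBar d α t g lam) := fun _ _ h =>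
  measure_mono fun _ hq => lt_of_le_of_lt h hq

theorem pker_scale {d : ℕ} {α : ℝ} (g : ℝ → ℝ) {a s : ℝ} (ha : 0 < a) (hs : 0 < s)
    (y : EuclideanSpace ℝ (Fin d)) :
    pker d α g (a * s) (a ^ ((1:ℝ) / α) • y) = a ^ (-((d:ℝ) / α)) * pker d α g s y := by
  unfold pker
  have h1 : 0 < a ^ ((1:ℝ) / α) := by positivity
  rw [Real.mul_rpow ha.le hs.le, Real.mul_rpow ha.le hs.le, norm_smul, Real.norm_of_nonneg h1.le,
    mul_div_mul_left _ _ h1.ne', mul_assoc]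

theorem volume_lt_pker_scale {d : ℕ} {α : ℝ} (g : ℝ → ℝ) {a s : ℝ} (ha : 0 < a)
    (hs : 0 < s) (r z : ℝ) :
    volume {y : EuclideanSpace ℝ (Fin d) | a ^ (-((d:ℝ) / α)) * r < pker d α g (a * s) y * z} =
      ENNReal.ofReal (a ^ ((d:ℝ) / α)) *
        volume {y : EuclideanSpace ℝ (Fin d) | r < pker d α g s y * z} := by
  have h1 : 0 < a ^ ((1:ℝ) / α) := by positivity
  have h2 : 0 < a ^ (-((d:ℝ) / α)) := by positivity
  have : {y : EuclideanSpace ℝ (Fin d) | r < pker d α g s y * z} = (a ^ ((1:ℝ) / α) • ·) ⁻¹'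
      {y | a ^ (-((d:ℝ) / α)) * r < pker d α g (a * s) y * z} := by
    ext y
    simp only [mem_ofPred_eq, mem_preimage, pker_scale g ha hs, mul_assoc, mul_lt_mul_iff_right₀ h2]
  rw [this, Measure.addHaar_preimage_smul _ h1.ne', ← mul_assoc, ← ENNReal.ofReal_mul (by positivity)]
  have h3 : a ^ ((d:ℝ) / α) = (a ^ ((1:ℝ) / α)) ^ d := by
    rw [← Real.rpow_natCast, ← Real.rpow_mul ha.le]
    congr 1
    ring
  rw [finrank_euclideanSpace, Fintype.card_fin, h3, abs_of_pos (by positivity),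
    mul_inv_cancel₀ (by positivity), ENNReal.ofReal_one, one_mul]

theorem lintegral_Ioc_comp_mul_left_le {a t : ℝ} (ha : 0 < a) (ha1 : a ≤ 1)
    (F : ℝ → ℝ≥0∞) :
    ENNReal.ofReal a * ∫⁻ s in Ioc (0:ℝ) t, F (a * s) ≤ ∫⁻ s in Ioc (0:ℝ) t, F s := by
  let e : ℝ ≃ᵐ ℝ := (Homeomorph.mulLeft₀ a ha.ne').toMeasurableEquiv
  have he : ∀ s, e s = a * s := fun s => rfl
  calc ENNReal.ofReal a * ∫⁻ s in Ioc (0:ℝ) t, F (a * s)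
      ≤ ENNReal.ofReal a * ∫⁻ s, (Ioc (0:ℝ) t).indicator F (e s) := by
        rw [← lintegral_indicator measurableSet_Ioc]
        gcongr with s
        by_cases hs : s ∈ Ioc (0:ℝ) t
        · rw [indicator_of_mem hs, indicator_of_mem, he]
          rw [he]
          exact ⟨mul_pos ha hs.1, (mul_le_of_le_one_left hs.1.le ha1).trans hs.2⟩
        · rw [indicator_of_notMem hs]
          exact zero_le
    _ = ∫⁻ s, (Ioc (0:ℝ) t).indicator F s := by
        rw [← lintegral_map_equiv]
        conv_rhs => rw [← Real.smul_map_volume_mul_left ha.ne', abs_of_pos ha,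
          lintegral_smul_measure]
        rfl
    _ = _ := lintegral_indicator measurableSet_Ioc _

theorem mul_etaBar_le_etaBar_mul {d : ℕ} (hd : 1 ≤ d) {α t : ℝ} (hα : 0 < α)
    {g : ℝ → ℝ} (hg : Continuous g) {lam : Measure ℝ} [SigmaFinite lam] {c : ℝ} (hc : 1 ≤ c)
    (r : ℝ) :
    ENNReal.ofReal (c ^ (-(1 + α / (d:ℝ)))) * etaBar d α t g lam r ≤
      etaBar d α t g lam (c * r) := by
  have hd0 : (0:ℝ) < d := by exact_mod_cast hd
  have hc0 : 0 < c := by linarith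
  set a : ℝ := c ^ (-(α / d)) with ha_def
  have ha : 0 < a := by positivity
  have ha1 : a ≤ 1 := Real.rpow_le_one_of_one_le_of_nonpos hc (by
    have : 0 < α / d := by positivity
    linarith)
  have hac : a ^ (-((d:ℝ) / α)) = c := by
    rw [ha_def, ← Real.rpow_mul hc0.le]
    have : -(α / (d:ℝ)) * -((d:ℝ) / α) = 1 := by field_simp
    rw [this, Real.rpow_one]
  have hac' : c ^ (-(1 + α / (d:ℝ))) = a * a ^ ((d:ℝ) / α) := by
    rw [ha_def, ← Real.rpow_mul hc0.le, ← Real.rpow_add hc0]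
    congr 1
    field_simp
    ring
  rw [etaBar_eq_lintegral hg, etaBar_eq_lintegral hg, hac', ENNReal.ofReal_mul ha.le, mul_assoc]
  refine le_trans (le_of_eq ?_) (lintegral_Ioc_comp_mul_left_le ha ha1 _)
  congr 1
  rw [← lintegral_const_mul' _ _ ENNReal.ofReal_ne_top]
  refine setLIntegral_congr_fun measurableSet_Ioc fun s hs => ?_
  rw [← lintegral_const_mul' _ _ ENNReal.ofReal_ne_top]
  refine lintegral_congr fun z => ?_
  rw [← volume_lt_pker_scale g ha hs.1, hac]

theorem measure_pker_eq_zero {d : ℕ} (hd : 1 ≤ d) {α t : ℝ} {g : ℝ → ℝ} (hg : Continuous g)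
    (hg_anti : StrictAntiOn g (Ici 0)) {lam : Measure ℝ} [SigmaFinite lam] (r : ℝ) :
    sourceMeasure d t lam {q | pker d α g q.1 q.2.1 * q.2.2 = r} = 0 := by
  have hmeas : MeasurableSet {q : ℝ × EuclideanSpace ℝ (Fin d) × ℝ |
      pker d α g q.1 q.2.1 * q.2.2 = r} := measurable_pker hg (measurableSet_singleton r)
  have : Nonempty (Fin d) := ⟨⟨0, hd⟩⟩
  have key : ∀ s : ℝ, 0 < s → ∀ z : ℝ, 0 < z →
      volume {y : EuclideanSpace ℝ (Fin d) | pker d α g s y * z = r} = 0 := by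
    intro s hs z hz
    rcases eq_empty_or_nonempty {y : EuclideanSpace ℝ (Fin d) | pker d α g s y * z = r} with h | h
    · rw [h, measure_empty]
    obtain ⟨y₀, hy₀⟩ := h
    refine measure_mono_null (t := Metric.sphere 0 ‖y₀‖) ?_ (Measure.addHaar_sphere _ _ _)
    intro y hy
    have h1 : pker d α g s y * z = pker d α g s y₀ * z := Eq.trans hy (Eq.symm hy₀)
    have h2 := mul_right_cancel₀ hz.ne' h1
    unfold pker at h2
    have h3 := mul_left_cancel₀ (Real.rpow_pos_of_pos hs _).ne' h2
    have hp : 0 < s ^ ((1:ℝ) / α) := by positivity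
    have h4 := hg_anti.injOn (by simp only [mem_Ici]; positivity)
      (by simp only [mem_Ici]; positivity) h3
    rw [div_left_inj' hp.ne'] at h4
    simpa using h4
  refine (Measure.measure_prod_null hmeas).2 ?_
  filter_upwards [ae_restrict_mem measurableSet_Ioc] with s hs
  rw [Measure.prod_apply_symm (measurable_prodMk_left hmeas)]
  exact (setLIntegral_congr_fun measurableSet_Ioi fun z hz => key s hs.1 z hz).trans lintegral_zero

theorem continuousAt_etaBar {d : ℕ} (hd : 1 ≤ d) {α t : ℝ} {g : ℝ → ℝ} (hg : Continuous g)
    (hg_anti : StrictAntiOn g (Ici 0)) {lam : Measure ℝ} [SigmaFinite lam]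
    (hfin : ∀ r, 0 < r → etaBar d α t g lam r ≠ ⊤) {r : ℝ} (hr : 0 < r) :
    ContinuousAt (etaBar d α t g lam) r := by
  refine tendsto_measure_of_ae_tendsto_indicator (μ := sourceMeasure d t lam) (𝓝 r)
    (measurableSet_lt_pker hg r) (fun r' => measurableSet_lt_pker hg r')
    (measurableSet_lt_pker hg (r / 2)) (hfin _ (half_pos hr)) ?_ ?_
  · filter_upwards [lt_mem_nhds (half_lt_self hr)] with r' hr' q hq
    exact lt_trans hr' hq
  · have h0 : ∀ᵐ q ∂sourceMeasure d t lam, ¬ pker d α g q.1 q.2.1 * q.2.2 = r := by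
      rw [ae_iff]
      simpa using measure_pker_eq_zero hd hg hg_anti r
    filter_upwards [h0] with q hq
    rcases lt_or_gt_of_ne hq with h | h
    · filter_upwards [lt_mem_nhds h] with r' hr'
      exact iff_of_false (not_lt_of_gt hr') (not_lt_of_gt h)
    · filter_upwards [gt_mem_nhds h] with r' hr'
      exact iff_of_true hr' h

theorem le_of_lt_pker {d : ℕ} (hd : 1 ≤ d) {α : ℝ} (hα : 0 < α) {g : ℝ → ℝ}
    (hg_le : ∀ x, 0 ≤ x → g x ≤ g 0) {r s z : ℝ} (hr : 0 < r)
    (hs : 0 < s) (hz : 0 < z) {y : EuclideanSpace ℝ (Fin d)} (h : r < pker d α g s y * z) :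
    s ≤ (g 0 * z / r) ^ (α / (d:ℝ)) := by
  have hd0 : (0:ℝ) < d := by exact_mod_cast hd
  have h1 : pker d α g s y ≤ s ^ (-((d:ℝ) / α)) * g 0 := by
    unfold pker
    gcongr
    exact hg_le _ (by positivity)
  have h2 : r < s ^ (-((d:ℝ) / α)) * g 0 * z := h.trans_le (by gcongr)
  have hp : 0 < s ^ ((d:ℝ) / α) := by positivity
  rw [Real.rpow_neg hs.le] at h2
  have h3 : s ^ ((d:ℝ) / α) ≤ g 0 * z / r := by
    rw [le_div_iff₀ hr]
    calc s ^ ((d:ℝ) / α) * r ≤ s ^ ((d:ℝ) / α) * ((s ^ ((d:ℝ) / α))⁻¹ * g 0 * z) := by gcongr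
      _ = g 0 * z := by field_simp
  calc s = (s ^ ((d:ℝ) / α)) ^ (α / (d:ℝ)) := by
        rw [← Real.rpow_mul hs.le]
        have : (d:ℝ) / α * (α / (d:ℝ)) = 1 := by field_simp
        rw [this, Real.rpow_one]
    _ ≤ _ := by gcongr

theorem norm_rpow_le_of_lt_pker {d : ℕ} {α : ℝ} (hα : 0 < α) {g : ℝ → ℝ} {C : ℝ}
    (hC : ∀ x : ℝ, 0 ≤ x → x ^ ((d:ℝ) + α) * g x ≤ C) {r s z : ℝ} (hr : 0 < r) (hs : 0 < s)
    (hz : 0 < z) {y : EuclideanSpace ℝ (Fin d)} (h : r < pker d α g s y * z) :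
    ‖y‖ ^ ((d:ℝ) + α) ≤ C * z * s / r := by
  unfold pker at h
  have hp : 0 < s ^ ((1:ℝ) / α) := by positivity
  set x := ‖y‖ / s ^ ((1:ℝ) / α) with hx
  have hx0 : 0 ≤ x := by positivity
  have hy : ‖y‖ = x * s ^ ((1:ℝ) / α) := by rw [hx]; field_simp
  have hpow : (s ^ ((1:ℝ) / α)) ^ ((d:ℝ) + α) * s ^ (-((d:ℝ) / α)) = s := by
    rw [← Real.rpow_mul hs.le, ← Real.rpow_add hs]
    have : 1 / α * ((d:ℝ) + α) + -((d:ℝ) / α) = 1 := by field_simp; ring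
    rw [this, Real.rpow_one]
  rw [le_div_iff₀ hr, hy, Real.mul_rpow hx0 hp.le]
  calc x ^ ((d:ℝ) + α) * (s ^ ((1:ℝ) / α)) ^ ((d:ℝ) + α) * r
      ≤ x ^ ((d:ℝ) + α) * (s ^ ((1:ℝ) / α)) ^ ((d:ℝ) + α) *
        (s ^ (-((d:ℝ) / α)) * g x * z) := by gcongr
    _ = (x ^ ((d:ℝ) + α) * g x) * z *
        ((s ^ ((1:ℝ) / α)) ^ ((d:ℝ) + α) * s ^ (-((d:ℝ) / α))) := by ring
    _ ≤ C * z * s := by rw [hpow]; gcongr; exact hC x hx0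

theorem volume_setOf_norm_rpow_le {d : ℕ} (hd : 1 ≤ d) {p b : ℝ} (hp : 0 < p) (hb : 0 ≤ b) :
    volume {y : EuclideanSpace ℝ (Fin d) | ‖y‖ ^ p ≤ b} ≤
      ENNReal.ofReal (b ^ ((d:ℝ) / p)) * volume (Metric.ball (0 : EuclideanSpace ℝ (Fin d)) 1) := by
  have : Nonempty (Fin d) := ⟨⟨0, hd⟩⟩
  have h : {y : EuclideanSpace ℝ (Fin d) | ‖y‖ ^ p ≤ b} ⊆ Metric.closedBall 0 (b ^ p⁻¹) := by
    intro y hy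
    rw [mem_closedBall_zero_iff]
    exact (Real.le_rpow_inv_iff_of_pos (norm_nonneg y) hb hp).2 hy
  refine (measure_mono h).trans_eq ?_
  rw [Measure.addHaar_closedBall _ _ (by positivity), finrank_euclideanSpace, Fintype.card_fin,
    ← Real.rpow_natCast, ← Real.rpow_mul hb]
  congr 3
  ring

/-- For each `z`, the times `s ≤ t` that contribute to `η̄(r)` are at most `min t (g(0) z / r)^{α/d}`,
and each of them contributes a ball of controlled volume. -/
theorem etaBar_le_lintegral {d : ℕ} (hd : 1 ≤ d) {α t : ℝ} (hα : 0 < α) {g : ℝ → ℝ}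
    (hg : Continuous g) (hg_le : ∀ x, 0 ≤ x → g x ≤ g 0) (hg0 : 0 < g 0) {C : ℝ} (hC0 : 0 < C)
    (hC : ∀ x : ℝ, 0 ≤ x → x ^ ((d:ℝ) + α) * g x ≤ C) {lam : Measure ℝ} [SigmaFinite lam]
    (ht : 0 < t) {r : ℝ} (hr : 0 < r) :
    etaBar d α t g lam r ≤ volume (Metric.ball (0 : EuclideanSpace ℝ (Fin d)) 1) *
      ∫⁻ z in Ioi (0:ℝ), ENNReal.ofReal
        ((C * z * min t ((g 0 * z / r) ^ (α / (d:ℝ))) / r) ^ ((d:ℝ) / ((d:ℝ) + α)) *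
          min t ((g 0 * z / r) ^ (α / (d:ℝ)))) ∂lam := by
  set M : ℝ → ℝ := fun z => min t ((g 0 * z / r) ^ (α / (d:ℝ))) with hM
  set V := volume (Metric.ball (0 : EuclideanSpace ℝ (Fin d)) 1) with hV
  set W : ℝ → ℝ≥0∞ := fun z =>
    ENNReal.ofReal ((C * z * M z / r) ^ ((d:ℝ) / ((d:ℝ) + α))) * V with hW
  have hMm : Measurable M := by fun_prop
  have hWm : Measurable W := by fun_prop
  have hM0 : ∀ z, 0 < z → 0 < M z := fun z hz => lt_min ht (by positivity)
  calc etaBar d α t g lam r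
      = ∫⁻ s in Ioc (0:ℝ) t, ∫⁻ z in Ioi (0:ℝ),
          volume {y : EuclideanSpace ℝ (Fin d) | r < pker d α g s y * z} ∂lam :=
        etaBar_eq_lintegral hg r
    _ ≤ ∫⁻ s in Ioc (0:ℝ) t, ∫⁻ z in Ioi (0:ℝ), (if s ≤ M z then W z else 0) ∂lam := by
        refine setLIntegral_mono' measurableSet_Ioc fun s hs => ?_
        refine setLIntegral_mono' measurableSet_Ioi fun z (hz : 0 < z) => ?_
        split_ifs with hsM
        · have hb : 0 ≤ C * z * M z / r := by have := hM0 z hz; positivity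
          refine (measure_mono fun y hy => ?_).trans
            (volume_setOf_norm_rpow_le (d := d) (p := (d:ℝ) + α) hd (by positivity) hb)
          refine (norm_rpow_le_of_lt_pker hα hC hr hs.1 hz hy).trans ?_
          gcongr
        · rw [nonpos_iff_eq_zero]
          refine (congrArg volume ?_).trans measure_empty
          rw [eq_empty_iff_forall_notMem]
          intro y hy
          exact hsM (le_min hs.2 (le_of_lt_pker hd hα hg_le hr hs.1 hz hy))
    _ = ∫⁻ z in Ioi (0:ℝ), (∫⁻ s in Ioc (0:ℝ) t, if s ≤ M z then W z else 0) ∂lam := by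
        refine lintegral_lintegral_swap (Measurable.aemeasurable ?_)
        exact Measurable.ite (measurableSet_le measurable_fst (hMm.comp measurable_snd))
          (hWm.comp measurable_snd) measurable_const
    _ ≤ ∫⁻ z in Ioi (0:ℝ), V * ENNReal.ofReal
          ((C * z * M z / r) ^ ((d:ℝ) / ((d:ℝ) + α)) * M z) ∂lam := by
        refine setLIntegral_mono' measurableSet_Ioi fun z (hz : 0 < z) => ?_
        have hMz := hM0 z hz
        calc ∫⁻ s in Ioc (0:ℝ) t, (if s ≤ M z then W z else 0)
            ≤ ∫⁻ s, (Ioc (0:ℝ) (M z)).indicator (fun _ => W z) s := by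
              rw [← lintegral_indicator measurableSet_Ioc]
              refine lintegral_mono fun s => ?_
              by_cases h1 : s ∈ Ioc (0:ℝ) t
              · rw [indicator_of_mem h1]
                split_ifs with h2
                · rw [indicator_of_mem (show s ∈ Ioc (0:ℝ) (M z) from ⟨h1.1, h2⟩)]
                · exact zero_le
              · rw [indicator_of_notMem h1]
                exact zero_le
          _ = V * ENNReal.ofReal ((C * z * M z / r) ^ ((d:ℝ) / ((d:ℝ) + α)) * M z) := by
              rw [lintegral_indicator_const measurableSet_Ioc, Real.volume_Ioc, sub_zero,
                ENNReal.ofReal_mul (by positivity)]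
              ring
    _ = _ := lintegral_const_mul _ (by fun_prop)

theorem etaBar_ne_top {d : ℕ} (hd : 1 ≤ d) {α t : ℝ} (hα : 0 < α) {g : ℝ → ℝ}
    (hg : Continuous g) (hg_le : ∀ x, 0 ≤ x → g x ≤ g 0) (hg0 : 0 < g 0) {C : ℝ} (hC0 : 0 < C)
    (hC : ∀ x : ℝ, 0 ≤ x → x ^ ((d:ℝ) + α) * g x ≤ C) {lam : Measure ℝ} [SigmaFinite lam]
    (ht : 0 < t)
    (hsmall : ∫⁻ z in Ioc (0:ℝ) 1, ENNReal.ofReal (z ^ (1 + α / (d:ℝ))) ∂lam ≠ ⊤)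
    (hbig : ∫⁻ z in Ioi (1:ℝ), ENNReal.ofReal (z ^ ((d:ℝ) / ((d:ℝ) + α))) ∂lam ≠ ⊤)
    {r : ℝ} (hr : 0 < r) : etaBar d α t g lam r ≠ ⊤ := by
  have hd0 : (0:ℝ) < d := by exact_mod_cast hd
  refine ne_top_of_le_ne_top (ENNReal.mul_ne_top measure_ball_lt_top.ne ?_)
    (etaBar_le_lintegral hd hα hg hg_le hg0 hC0 hC ht hr)
  set A := (g 0 / r) ^ (α / (d:ℝ)) with hA
  set β := (d:ℝ) / ((d:ℝ) + α) with hβ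
  have hA0 : 0 < A := by positivity
  have hAz : ∀ z : ℝ, 0 < z → (g 0 * z / r) ^ (α / (d:ℝ)) = A * z ^ (α / (d:ℝ)) := by
    intro z hz
    rw [hA, ← Real.mul_rpow (by positivity) hz.le]
    congr 1
    ring
  rw [← Ioc_union_Ioi_eq_Ioi (zero_le_one' ℝ),
    lintegral_union measurableSet_Ioi (Ioc_disjoint_Ioi le_rfl)]
  refine ENNReal.add_ne_top.2 ⟨?_, ?_⟩
  · refine ne_top_of_le_ne_top (ENNReal.mul_ne_top
      (ENNReal.ofReal_ne_top (r := (C * A / r) ^ β * A)) hsmall) ?_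
    rw [← lintegral_const_mul' _ _ ENNReal.ofReal_ne_top]
    refine setLIntegral_mono' measurableSet_Ioc fun z hz => ?_
    have hz0 := hz.1
    rw [← ENNReal.ofReal_mul (by positivity), hAz z hz0]
    have hm0 : 0 ≤ min t (A * z ^ (α / (d:ℝ))) := by positivity
    refine ENNReal.ofReal_le_ofReal ?_
    have hz1 : (z * z ^ (α / (d:ℝ))) ^ β = z := by
      nth_rewrite 1 [← Real.rpow_one z]
      rw [← Real.rpow_add hz0, ← Real.rpow_mul hz0.le]
      have : (1 + α / (d:ℝ)) * β = 1 := by rw [hβ]; field_simp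
      rw [this, Real.rpow_one]
    calc (C * z * min t (A * z ^ (α / (d:ℝ))) / r) ^ β * min t (A * z ^ (α / (d:ℝ)))
        ≤ (C * z * (A * z ^ (α / (d:ℝ))) / r) ^ β * (A * z ^ (α / (d:ℝ))) := by
          gcongr <;> exact min_le_right _ _
      _ = (C * A / r * (z * z ^ (α / (d:ℝ)))) ^ β * (A * z ^ (α / (d:ℝ))) := by
          congr 2
          ring
      _ = (C * A / r) ^ β * A * z ^ (1 + α / (d:ℝ)) := by
          rw [Real.mul_rpow (by positivity) (by positivity), hz1, Real.rpow_add hz0,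
            Real.rpow_one]
          ring
  · refine ne_top_of_le_ne_top (ENNReal.mul_ne_top
      (ENNReal.ofReal_ne_top (r := (C * t / r) ^ β * t)) hbig) ?_
    rw [← lintegral_const_mul' _ _ ENNReal.ofReal_ne_top]
    refine setLIntegral_mono' measurableSet_Ioi fun z (hz : 1 < z) => ?_
    have hz0 : 0 < z := by linarith
    rw [← ENNReal.ofReal_mul (by positivity)]
    have hm0 : 0 ≤ min t ((g 0 * z / r) ^ (α / (d:ℝ))) := by positivity
    refine ENNReal.ofReal_le_ofReal ?_
    calc (C * z * min t ((g 0 * z / r) ^ (α / (d:ℝ))) / r) ^ β *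
          min t ((g 0 * z / r) ^ (α / (d:ℝ)))
        ≤ (C * z * t / r) ^ β * t := by
          gcongr <;> exact min_le_left _ _
      _ = (C * t / r * z) ^ β * t := by
          congr 2
          ring
      _ = (C * t / r) ^ β * t * z ^ β := by
          rw [Real.mul_rpow (by positivity) hz0.le]
          ring

theorem exists_etaBar_ne_zero {d : ℕ} {α t : ℝ} (ht : 0 < t) {g : ℝ → ℝ}
    (hg_pos : ∀ x, 0 ≤ x → 0 < g x) {lam : Measure ℝ} [SigmaFinite lam]
    (hlam : lam (Ioi 0) ≠ 0) : ∃ r, 0 < r ∧ etaBar d α t g lam r ≠ 0 := by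
  by_contra! h
  have h0 : ∀ᵐ q ∂sourceMeasure d t lam, ∀ n : ℕ,
      ¬ (1 / ((n:ℝ) + 1) < pker d α g q.1 q.2.1 * q.2.2) := by
    rw [ae_all_iff]
    intro n
    rw [ae_iff]
    simp only [not_not]
    exact h (1 / ((n:ℝ) + 1)) (by positivity)
  have h1 : ∀ᵐ q ∂sourceMeasure d t lam, False := by
    filter_upwards [h0, ae_sourceMeasure d t lam] with q hq hpos
    have hs := hpos.1
    have hp : 0 < pker d α g q.1 q.2.1 * q.2.2 :=
      mul_pos (mul_pos (by positivity) (hg_pos _ (by positivity))) hpos.2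
    obtain ⟨n, hn⟩ := exists_nat_one_div_lt hp
    exact hq n hn
  rw [eventually_false_iff_eq_bot, ae_eq_bot] at h1
  have h2 := congrArg (fun m : Measure (ℝ × EuclideanSpace ℝ (Fin d) × ℝ) => m univ) h1
  rw [sourceMeasure, ← univ_prod_univ, ← univ_prod_univ, Measure.prod_prod, Measure.prod_prod] at h2
  have hvol : (volume : Measure (EuclideanSpace ℝ (Fin d))) univ ≠ 0 :=
    isOpen_univ.measure_ne_zero _ univ_nonempty
  simp only [Measure.restrict_apply_univ, Real.volume_Ioc, sub_zero, Measure.coe_zero,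
    Pi.zero_apply, mul_eq_zero, ENNReal.ofReal_eq_zero, not_le.2 ht, hvol, hlam, or_self] at h2

theorem extendedRegularVariation_of_antitone {f : ℝ → ℝ} {γ r₀ : ℝ} (hγ : 0 ≤ γ)
    (hpos : ∀ r, r₀ ≤ r → 0 < f r) (hanti : AntitoneOn f (Ici r₀))
    (hscale : ∀ c r, 1 ≤ c → r₀ ≤ r → c ^ (-γ) * f r ≤ f (c * r)) :
    ExtendedRegularVariation f := by
  refine ⟨γ, 0, hγ, le_rfl, fun c hc => ?_⟩
  have hlow : ∀ᶠ s in atTop, c ^ (-γ) ≤ f (c * s) / f s := by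
    filter_upwards [eventually_ge_atTop r₀] with s hs
    exact (le_div_iff₀ (hpos s hs)).2 (hscale c s hc hs)
  have hup : ∀ᶠ s in atTop, f (c * s) / f s ≤ c ^ (0:ℝ) := by
    filter_upwards [eventually_ge_atTop r₀, eventually_ge_atTop 0] with s hs hs0
    rw [Real.rpow_zero, div_le_one (hpos s hs)]
    have : s ≤ c * s := le_mul_of_one_le_left hs0 hc
    exact hanti hs (hs.trans this) this
  have hb : IsBoundedUnder (· ≤ ·) atTop fun s => f (c * s) / f s := ⟨_, hup⟩
  have hb' : IsBoundedUnder (· ≥ ·) atTop fun s => f (c * s) / f s := ⟨_, hlow⟩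
  exact ⟨le_liminf_of_le hb.isCoboundedUnder_ge hlow, liminf_le_limsup hb hb',
    limsup_le_of_le hb'.isCoboundedUnder_le hup⟩

theorem exists_rpow_mul_le {g : ℝ → ℝ} {p c₀ : ℝ} (hp : 0 < p) (hg_le : ∀ x, 0 ≤ x → g x ≤ g 0)
    (hg_pos : ∀ x, 0 ≤ x → 0 < g x) (hg_tail : Tendsto (fun r : ℝ => r ^ p * g r) atTop (𝓝 c₀)) :
    ∃ C, 0 < C ∧ ∀ x, 0 ≤ x → x ^ p * g x ≤ C := by
  obtain ⟨R, hR⟩ := eventually_atTop.1 (hg_tail.eventually (gt_mem_nhds (lt_add_one c₀)))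
  set R' := max R 1
  have hR' : 0 < R' := lt_max_of_lt_right one_pos
  have hg0 := hg_pos 0 le_rfl
  refine ⟨max (c₀ + 1) (R' ^ p * g 0), lt_max_of_lt_right (by positivity), fun x hx => ?_⟩
  rcases le_total R' x with h | h
  · exact (hR x ((le_max_left _ _).trans h)).le.trans (le_max_left _ _)
  · refine le_trans ?_ (le_max_right _ _)
    have := hg_pos x hx
    gcongr
    exact hg_le x hx

theorem stmt6 (d : ℕ) (hd : 1 ≤ d) (α : ℝ) (hα : α ∈ Set.Ioo (0:ℝ) 2) (t : ℝ) (ht : 0 < t)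
    (lam : MeasureTheory.Measure ℝ) [SigmaFinite lam]
    (hlam0 : lam (Set.Iic 0) = 0) (hlam_ne : lam ≠ 0)
    (hmom : ∫⁻ z in Set.Ioi (0:ℝ), ENNReal.ofReal (min 1 (z ^ 2)) ∂lam ≠ ⊤)
    (g : ℝ → ℝ) (hg_cont : ContinuousOn g (Set.Ici 0))
    (hg_anti : StrictAntiOn g (Set.Ici 0)) (hg_pos : ∀ x : ℝ, 0 ≤ x → 0 < g x)
    (c₀ : ℝ) (hc₀ : 0 < c₀)
    (hg_tail : Filter.Tendsto (fun r : ℝ => r ^ ((d:ℝ) + α) * g r) Filter.atTop (nhds c₀))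
    (hsmall : ∫⁻ z in Set.Ioc (0:ℝ) 1, ENNReal.ofReal (z ^ (1 + α / (d:ℝ))) ∂lam ≠ ⊤)
    (hbig : ∫⁻ z in Set.Ioi (1:ℝ), ENNReal.ofReal (z ^ ((d:ℝ) / ((d:ℝ) + α))) ∂lam ≠ ⊤) :
    ContinuousOn (fun r => (etaBar d α t g lam r).toReal) (Set.Ioi 0) ∧
    AntitoneOn (fun r => (etaBar d α t g lam r).toReal) (Set.Ioi 0) ∧
    0 < Filter.liminf
        (fun r : ℝ => ENNReal.ofReal (r ^ (1 + α / (d:ℝ))) * etaBar d α t g lam r)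
        Filter.atTop ∧
    ExtendedRegularVariation (fun r => (etaBar d α t g lam r).toReal) := by
  have hα0 : 0 < α := hα.1
  have hd0 : (0:ℝ) < d := by exact_mod_cast hd
  set G : ℝ → ℝ := fun x => g (max x 0) with hG
  have hgG : ∀ x, 0 ≤ x → g x = G x := fun x hx => by simp only [hG, max_eq_left hx]
  have hG_cont : Continuous G :=
    hg_cont.comp_continuous (by fun_prop) fun x => le_max_right x 0
  have hG_anti : StrictAntiOn G (Ici 0) := hg_anti.congr hgG
  have hG_pos : ∀ x, 0 ≤ x → 0 < G x := fun x hx => hgG x hx ▸ hg_pos x hx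
  have hG_le : ∀ x, 0 ≤ x → G x ≤ G 0 := fun x hx =>
    hG_anti.antitoneOn self_mem_Ici hx hx
  have hG_tail : Tendsto (fun r : ℝ => r ^ ((d:ℝ) + α) * G r) atTop (𝓝 c₀) := by
    refine hg_tail.congr' ?_
    filter_upwards [eventually_ge_atTop 0] with r hr
    rw [hgG r hr]
  obtain ⟨C, hC0, hC⟩ := exists_rpow_mul_le (by positivity) hG_le hG_pos hG_tail
  rw [etaBar_congr hgG]
  have hfin : ∀ r, 0 < r → etaBar d α t G lam r ≠ ⊤ := fun r hr =>
    etaBar_ne_top hd hα0 hG_cont hG_le (hG_pos 0 le_rfl) hC0 hC ht hsmall hbig hr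
  have hscale : ∀ c r, 1 ≤ c → ENNReal.ofReal (c ^ (-(1 + α / (d:ℝ)))) * etaBar d α t G lam r ≤
      etaBar d α t G lam (c * r) := fun c r hc =>
    mul_etaBar_le_etaBar_mul hd hα0 hG_cont hc r
  have hlam : lam (Ioi 0) ≠ 0 := fun h => hlam_ne <| by
    rw [← Measure.measure_univ_eq_zero, ← Iic_union_Ioi (a := (0:ℝ))]
    exact measure_union_null hlam0 h
  obtain ⟨r₀, hr₀, hne⟩ := exists_etaBar_ne_zero (d := d) (α := α) ht hG_pos hlam
  have hanti : AntitoneOn (fun r => (etaBar d α t G lam r).toReal) (Ioi 0) :=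
    fun a ha b _ hab => ENNReal.toReal_mono (hfin a ha) (etaBar_antitone hab)
  have hlow : ∀ r, r₀ ≤ r → ENNReal.ofReal (r₀ ^ (1 + α / (d:ℝ))) * etaBar d α t G lam r₀ ≤
      ENNReal.ofReal (r ^ (1 + α / (d:ℝ))) * etaBar d α t G lam r := by
    intro r hr
    have hr0 : 0 < r := hr₀.trans_le hr
    have h := hscale (r / r₀) r₀ ((one_le_div hr₀).2 hr)
    rw [div_mul_cancel₀ _ hr₀.ne'] at h
    refine le_trans (le_of_eq ?_) (mul_le_mul_right h _)
    rw [← mul_assoc, ← ENNReal.ofReal_mul (by positivity), Real.div_rpow hr0.le hr₀.le,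
      Real.rpow_neg hr0.le, Real.rpow_neg hr₀.le]
    congr 2
    field_simp
  have hlow_pos : 0 < ENNReal.ofReal (r₀ ^ (1 + α / (d:ℝ))) * etaBar d α t G lam r₀ :=
    ENNReal.mul_pos (ENNReal.ofReal_pos.2 (by positivity)).ne' hne
  refine ⟨fun r hr => ?_, hanti, ?_, ?_⟩
  · exact ((ENNReal.tendsto_toReal (hfin r hr)).comp
      (continuousAt_etaBar hd hG_cont hG_anti hfin hr)).mono_left nhdsWithin_le_nhds
  · refine hlow_pos.trans_le (le_liminf_of_le (by isBoundedDefault) ?_)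
    filter_upwards [eventually_ge_atTop r₀] with r hr using hlow r hr
  · refine extendedRegularVariation_of_antitone (γ := 1 + α / (d:ℝ)) (r₀ := r₀) (by positivity)
      (fun r hr => ?_) (hanti.mono fun r hr => hr₀.trans_le hr) fun c r hc hr => ?_
    · refine ENNReal.toReal_pos ?_ (hfin r (hr₀.trans_le hr))
      exact (pos_of_mul_pos_right (hlow_pos.trans_le (hlow r hr)) zero_le).ne'
    · have hr0 : 0 < r := hr₀.trans_le hr
      have h := ENNReal.toReal_mono (hfin (c * r) (by positivity)) (hscale c r hc)
      rwa [ENNReal.toReal_mul, ENNReal.toReal_ofReal (by positivity)] at h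
end

section
/- Assume ∫_{(0,1]} z^{1+α/d} λ(dz) < ∞ and ∫_{(1,∞)} z^{d/(d+α)} λ(dz) < ∞, and suppose there are β with d/(d+α) < β < 1 + α/d and a slowly varying function l at infinity such that λ̄(r) ≍ l(r)/r^{β} for r ≥ 1. Then η̄(r) ≍ λ̄(r) as r → ∞. -/
open MeasureTheory Set Filter Topology
open scoped ENNReal NNReal

/-- `l : (0,∞) → (0,∞)` is slowly varying at infinity if `l(cr)/l(r) → 1` as `r → ∞`
for every `c > 0`. -/
def SlowlyVarying (l : ℝ → ℝ) : Prop :=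
  ∀ c : ℝ, 0 < c → Filter.Tendsto (fun r => l (c * r) / l r) Filter.atTop (nhds 1)

/-- A power integral over a bounded interval is at most the top value of the power times the
tail of the measure. -/
theorem setLIntegral_Ioc_rpow_le (μ : Measure ℝ) {a b p : ℝ} (ha : 0 ≤ a) (hp : 0 ≤ p)
    (hfin : μ (Ioi a) ≠ ⊤) :
    ∫⁻ z in Ioc a b, ENNReal.ofReal (z ^ p) ∂μ
      ≤ ENNReal.ofReal (b ^ p * (μ (Ioi a)).toReal) := by
  calc ∫⁻ z in Ioc a b, ENNReal.ofReal (z ^ p) ∂μ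
      ≤ ∫⁻ _ in Ioc a b, ENNReal.ofReal (b ^ p) ∂μ := by
        refine setLIntegral_mono measurable_const fun z hz => ?_
        exact ENNReal.ofReal_le_ofReal (Real.rpow_le_rpow (ha.trans hz.1.le) hz.2 hp)
    _ = ENNReal.ofReal (b ^ p) * μ (Ioc a b) := setLIntegral_const _ _
    _ ≤ ENNReal.ofReal (b ^ p) * μ (Ioi a) := by gcongr; exact Ioc_subset_Ioi_self
    _ = ENNReal.ofReal (b ^ p * (μ (Ioi a)).toReal) := by
        rw [ENNReal.ofReal_mul' ENNReal.toReal_nonneg, ENNReal.ofReal_toReal hfin]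

/-- Tail moments are controlled by the tail when the tail decays fast enough along a geometric
scale. -/
theorem exists_setLIntegral_Ioi_rpow_le (μ : Measure ℝ) {c R θ κ : ℝ} (hc : 1 < c) (hR : 0 < R)
    (hθ : 0 ≤ θ) (hκc : κ * c ^ θ < 1) (hfin : ∀ r, R ≤ r → μ (Ioi r) ≠ ⊤)
    (hdec : ∀ r, R ≤ r → (μ (Ioi (c * r))).toReal ≤ κ * (μ (Ioi r)).toReal) :
    ∃ M : ℝ, 0 < M ∧ ∀ r, R ≤ r →
      ∫⁻ z in Ioi r, ENNReal.ofReal (z ^ θ) ∂μ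
        ≤ ENNReal.ofReal (M * (r ^ θ * (μ (Ioi r)).toReal)) := by
  have hcθ : 0 < c ^ θ := Real.rpow_pos_of_pos (by linarith) _
  have hden : 0 < 1 - κ * c ^ θ := by linarith
  set M : ℝ := c ^ θ / (1 - κ * c ^ θ) with hM
  have hM0 : 0 < M := div_pos hcθ hden
  have hMeq : c ^ θ + M * (κ * c ^ θ) = M := by
    have : M * (1 - κ * c ^ θ) = c ^ θ := div_mul_cancel₀ _ hden.ne'
    linarith
  have key : ∀ (T : ℝ) (n : ℕ) (r : ℝ), R ≤ r → T ≤ c ^ n * r →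
      ∫⁻ z in Ioc r T, ENNReal.ofReal (z ^ θ) ∂μ
        ≤ ENNReal.ofReal (M * (r ^ θ * (μ (Ioi r)).toReal)) := by
    intro T n
    induction n with
    | zero =>
      intro r _ hT
      rw [Ioc_eq_empty (by simpa using hT)]
      simp
    | succ n ih =>
      intro r hr hT
      have hr0 : 0 < r := hR.trans_le hr
      have hcr : R ≤ c * r := by nlinarith
      have h1 := ih (c * r) hcr (by rw [pow_succ] at hT; linarith)
      have h2 := setLIntegral_Ioc_rpow_le μ (b := c * r) hr0.le hθ (hfin r hr)
      have hpow : (c * r) ^ θ = c ^ θ * r ^ θ := Real.mul_rpow (by linarith) hr0.le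
      have hrθ : 0 < r ^ θ := Real.rpow_pos_of_pos hr0 _
      calc ∫⁻ z in Ioc r T, ENNReal.ofReal (z ^ θ) ∂μ
          ≤ ∫⁻ z in Ioc r (c * r) ∪ Ioc (c * r) T, ENNReal.ofReal (z ^ θ) ∂μ :=
            lintegral_mono_set fun z hz => by
              rcases le_or_gt z (c * r) with h | h
              · exact Or.inl ⟨hz.1, h⟩
              · exact Or.inr ⟨h, hz.2⟩
        _ ≤ _ := lintegral_union_le _ _ _
        _ ≤ _ := add_le_add h2 h1
        _ = ENNReal.ofReal ((c * r) ^ θ * (μ (Ioi r)).toReal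
              + M * ((c * r) ^ θ * (μ (Ioi (c * r))).toReal)) := by
            rw [ENNReal.ofReal_add] <;> positivity
        _ ≤ _ := by
            apply ENNReal.ofReal_le_ofReal
            rw [hpow]
            calc c ^ θ * r ^ θ * (μ (Ioi r)).toReal
                  + M * (c ^ θ * r ^ θ * (μ (Ioi (c * r))).toReal)
                ≤ c ^ θ * r ^ θ * (μ (Ioi r)).toReal
                  + M * (c ^ θ * r ^ θ * (κ * (μ (Ioi r)).toReal)) := by
                  gcongr; exact hdec r hr
              _ = (c ^ θ + M * (κ * c ^ θ)) * (r ^ θ * (μ (Ioi r)).toReal) := by ring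
              _ = _ := by rw [hMeq]
  refine ⟨M, hM0, fun r hr => ?_⟩
  have hr0 : 0 < r := hR.trans_le hr
  have hU : Ioi r = ⋃ N : ℕ, Ioc r (N : ℝ) := by
    ext z
    simp only [mem_Ioi, mem_iUnion, mem_Ioc, exists_and_left]
    exact ⟨fun h => ⟨h, exists_nat_ge z⟩, fun h => h.1⟩
  have hdir : Directed (· ⊆ ·) fun N : ℕ => Ioc r (N : ℝ) :=
    Monotone.directed_le fun a b hab => Ioc_subset_Ioc_right (by exact_mod_cast hab)
  conv_lhs => rw [hU]
  rw [setLIntegral_iUnion_of_directed _ hdir]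
  refine iSup_le fun N => ?_
  obtain ⟨n, hn⟩ := pow_unbounded_of_one_lt ((N : ℝ) / r) hc
  exact key N n r hr ((div_lt_iff₀ hr0).1 hn).le

/-- Truncated moments are controlled by the tail when the tail decays slowly enough along a
geometric scale. -/
theorem exists_setLIntegral_Ioc_rpow_le (μ : Measure ℝ) {c R p κ : ℝ} (hc : 1 < c) (hR : 0 < R)
    (hp : 0 ≤ p) (hκ : 0 ≤ κ) (hκc : κ < c ^ p) (hfin : ∀ r, R ≤ r → μ (Ioi r) ≠ ⊤)
    (hpos : ∀ r, R ≤ r → 0 < (μ (Ioi r)).toReal)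
    (hmom : ∫⁻ z in Ioc 0 (c * R), ENNReal.ofReal (z ^ p) ∂μ ≠ ⊤)
    (hdec : ∀ r, R ≤ r → (μ (Ioi r)).toReal ≤ κ * (μ (Ioi (c * r))).toReal) :
    ∃ M : ℝ, 0 < M ∧ ∀ r, R ≤ r →
      ∫⁻ z in Ioc 0 r, ENNReal.ofReal (z ^ p) ∂μ
        ≤ ENNReal.ofReal (M * (r ^ p * (μ (Ioi r)).toReal)) := by
  have hc0 : 0 < c := by linarith
  have hcp : 0 < c ^ p := Real.rpow_pos_of_pos hc0 _
  have hden : 0 < c ^ p - κ := by linarith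
  have hcR : R ≤ c * R := by nlinarith
  set A := (∫⁻ z in Ioc 0 (c * R), ENNReal.ofReal (z ^ p) ∂μ).toReal with hA
  have hA0 : 0 ≤ A := ENNReal.toReal_nonneg
  have hB0 : 0 < R ^ p * (μ (Ioi (c * R))).toReal :=
    mul_pos (Real.rpow_pos_of_pos hR _) (hpos _ hcR)
  set M : ℝ := c ^ p * κ / (c ^ p - κ) + A / (R ^ p * (μ (Ioi (c * R))).toReal) + 1 with hM
  have hM1 : c ^ p * κ / (c ^ p - κ) ≤ M := by
    have : 0 ≤ A / (R ^ p * (μ (Ioi (c * R))).toReal) := by positivity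
    linarith
  have hM2 : A / (R ^ p * (μ (Ioi (c * R))).toReal) ≤ M := by
    have : 0 ≤ c ^ p * κ / (c ^ p - κ) := by positivity
    linarith
  have hM0 : 0 < M := by positivity
  have hMle : (c ^ p + M) * κ ≤ M * c ^ p := by
    rw [div_le_iff₀ hden] at hM1
    linarith
  have key : ∀ (n : ℕ) (r : ℝ), R ≤ r → r ≤ c ^ (n + 1) * R →
      ∫⁻ z in Ioc 0 r, ENNReal.ofReal (z ^ p) ∂μ
        ≤ ENNReal.ofReal (M * (r ^ p * (μ (Ioi r)).toReal)) := by
    intro n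
    have hbase : ∀ r : ℝ, R ≤ r → r ≤ c * R →
        ∫⁻ z in Ioc 0 r, ENNReal.ofReal (z ^ p) ∂μ
          ≤ ENNReal.ofReal (M * (r ^ p * (μ (Ioi r)).toReal)) := by
      intro r hr hrc
      calc ∫⁻ z in Ioc 0 r, ENNReal.ofReal (z ^ p) ∂μ
          ≤ ∫⁻ z in Ioc 0 (c * R), ENNReal.ofReal (z ^ p) ∂μ :=
            lintegral_mono_set (Ioc_subset_Ioc_right hrc)
        _ = ENNReal.ofReal A := (ENNReal.ofReal_toReal hmom).symm
        _ ≤ _ := by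
          apply ENNReal.ofReal_le_ofReal
          rw [div_le_iff₀ hB0] at hM2
          refine hM2.trans ?_
          have := ENNReal.toReal_mono (hfin r hr) (measure_mono (μ := μ) (Ioi_subset_Ioi hrc))
          have hr0 : 0 < r := hR.trans_le hr
          gcongr
    induction n with
    | zero => intro r hr hrc; exact hbase r hr (by simpa using hrc)
    | succ n ih =>
      intro x hx hxc
      rcases le_or_gt x (c * R) with h | h
      · exact hbase x hx h
      obtain ⟨r, rfl⟩ : ∃ r, x = c * r := ⟨x / c, by field_simp⟩
      have hr : R ≤ r := le_of_lt (lt_of_mul_lt_mul_left h hc0.le)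
      have hr0 : 0 < r := hR.trans_le hr
      have h1 := ih r hr (le_of_mul_le_mul_left (by rw [pow_succ] at hxc; linarith) hc0)
      have h2 := setLIntegral_Ioc_rpow_le μ (b := c * r) hr0.le hp (hfin r hr)
      have hpow : (c * r) ^ p = c ^ p * r ^ p := Real.mul_rpow hc0.le hr0.le
      have hrp : 0 < r ^ p := Real.rpow_pos_of_pos hr0 _
      calc ∫⁻ z in Ioc 0 (c * r), ENNReal.ofReal (z ^ p) ∂μ
          ≤ ∫⁻ z in Ioc r (c * r) ∪ Ioc 0 r, ENNReal.ofReal (z ^ p) ∂μ :=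
            lintegral_mono_set fun z hz => by
              rcases le_or_gt z r with h | h
              · exact Or.inr ⟨hz.1, h⟩
              · exact Or.inl ⟨h, hz.2⟩
        _ ≤ _ := lintegral_union_le _ _ _
        _ ≤ _ := add_le_add h2 h1
        _ = ENNReal.ofReal ((c * r) ^ p * (μ (Ioi r)).toReal
              + M * (r ^ p * (μ (Ioi r)).toReal)) := by
            rw [ENNReal.ofReal_add] <;> positivity
        _ ≤ _ := by
            apply ENNReal.ofReal_le_ofReal
            rw [hpow]
            calc c ^ p * r ^ p * (μ (Ioi r)).toReal + M * (r ^ p * (μ (Ioi r)).toReal)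
                = (c ^ p + M) * r ^ p * (μ (Ioi r)).toReal := by ring
              _ ≤ (c ^ p + M) * r ^ p * (κ * (μ (Ioi (c * r))).toReal) := by
                  gcongr; exact hdec r hr
              _ = (c ^ p + M) * κ * (r ^ p * (μ (Ioi (c * r))).toReal) := by ring
              _ ≤ M * c ^ p * (r ^ p * (μ (Ioi (c * r))).toReal) := by gcongr
              _ = _ := by ring
  refine ⟨M, hM0, fun r hr => ?_⟩
  obtain ⟨n, hn⟩ := pow_unbounded_of_one_lt (r / R) hc
  refine key n r hr (((div_lt_iff₀ hR).1 hn).le.trans ?_)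
  gcongr
  · exact hc.le
  · omega

/-- A function comparable to `l r / r ^ β` with `l` slowly varying scales like `c ^ (-β)`, up to a
constant that does not depend on `c`. -/
theorem SlowlyVarying.eventually_scaling {l F : ℝ → ℝ} (hl : SlowlyVarying l)
    (hl_pos : ∀ x : ℝ, 0 < x → 0 < l x) {β C : ℝ} (hC : 1 ≤ C)
    (hF : ∀ r : ℝ, 1 ≤ r → C⁻¹ * (l r / r ^ β) ≤ F r ∧ F r ≤ C * (l r / r ^ β))
    {c : ℝ} (hc : 0 < c) :
    ∀ᶠ r in atTop, F (c * r) ≤ 2 * C ^ 2 * c ^ (-β) * F r ∧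
      F r ≤ 2 * C ^ 2 * c ^ β * F (c * r) := by
  have hC0 : 0 < C := by linarith
  have hlim := hl c hc
  filter_upwards [hlim.eventually_lt_const (show (1 : ℝ) < 2 by norm_num),
    hlim.eventually_const_lt (show (1 / 2 : ℝ) < 1 by norm_num), eventually_ge_atTop 1,
    eventually_ge_atTop c⁻¹] with r h1 h2 hr hcr
  have hr0 : 0 < r := by linarith
  have hcr1 : 1 ≤ c * r := by rwa [inv_le_iff_one_le_mul₀' hc] at hcr
  have hlr := hl_pos r hr0
  rw [div_lt_iff₀ hlr] at h1
  rw [lt_div_iff₀ hlr] at h2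
  have hpow : (c * r) ^ β = c ^ β * r ^ β := Real.mul_rpow hc.le hr0.le
  have hcβ : 0 < c ^ β := Real.rpow_pos_of_pos hc _
  have hrβ : 0 < r ^ β := Real.rpow_pos_of_pos hr0 _
  obtain ⟨a1, a2⟩ := hF r hr
  obtain ⟨b1, b2⟩ := hF (c * r) hcr1
  rw [inv_mul_le_iff₀ hC0] at a1 b1
  rw [hpow] at b1 b2
  constructor
  · calc F (c * r) ≤ C * (l (c * r) / (c ^ β * r ^ β)) := b2
      _ ≤ C * (2 * l r / (c ^ β * r ^ β)) := by gcongr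
      _ = 2 * C * c ^ (-β) * (l r / r ^ β) := by rw [Real.rpow_neg hc.le]; field_simp
      _ ≤ 2 * C * c ^ (-β) * (C * F r) := by gcongr
      _ = _ := by ring
  · calc F r ≤ C * (l r / r ^ β) := a2
      _ ≤ C * (2 * l (c * r) / r ^ β) := by gcongr; linarith
      _ = 2 * C * c ^ β * (l (c * r) / (c ^ β * r ^ β)) := by field_simp
      _ ≤ 2 * C * c ^ β * (C * F (c * r)) := by gcongr
      _ = _ := by ring

/-- A decreasing function with `x ^ q * g x` convergent satisfies a global
bound `x ^ q * g x ≤ K`. -/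
theorem exists_rpow_mul_le_of_tendsto {g : ℝ → ℝ} (hg_anti : AntitoneOn g (Ici 0))
    (hg0 : 0 ≤ g 0) {q c₀ : ℝ} (hq : 0 ≤ q)
    (hg_tail : Tendsto (fun r : ℝ => r ^ q * g r) atTop (𝓝 c₀)) :
    ∃ K : ℝ, 0 < K ∧ ∀ x, 0 ≤ x → x ^ q * g x ≤ K := by
  obtain ⟨X, hX⟩ := eventually_atTop.1 (hg_tail.eventually_le_const (lt_add_one c₀))
  refine ⟨max (c₀ + 1) ((max X 0) ^ q * g 0) + 1 + |c₀|, ?_, fun x hx => ?_⟩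
  · have := le_max_left (c₀ + 1) ((max X 0) ^ q * g 0)
    have := neg_abs_le c₀
    linarith
  · have h0 := abs_nonneg c₀
    rcases le_total X x with h | h
    · have := hX x h
      have := le_max_left (c₀ + 1) ((max X 0) ^ q * g 0)
      linarith
    · have h1 : x ^ q * g x ≤ (max X 0) ^ q * g 0 := by
        calc x ^ q * g x ≤ x ^ q * g 0 := by
              gcongr
              exact hg_anti (mem_Ici.2 le_rfl) (mem_Ici.2 hx) hx
          _ ≤ _ := by
              gcongr
              exact h.trans (le_max_left _ _)
      have := le_max_right (c₀ + 1) ((max X 0) ^ q * g 0)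
      linarith

/-- `etaBar` as the measure of a region for the unrestricted product measure. -/
theorem etaBar_eq (d : ℕ) (α t : ℝ) (g : ℝ → ℝ) (lam : Measure ℝ) [SFinite lam] (r : ℝ) :
    etaBar d α t g lam r =
      ((volume : Measure ℝ).prod ((volume : Measure (EuclideanSpace ℝ (Fin d))).prod lam))
        ({q : ℝ × EuclideanSpace ℝ (Fin d) × ℝ | r < pker d α g q.1 q.2.1 * q.2.2} ∩
          Ioc 0 t ×ˢ (univ ×ˢ Ioi 0)) := by
  unfold etaBar
  conv_lhs =>
    rw [← Measure.restrict_univ (μ := (volume : Measure (EuclideanSpace ℝ (Fin d))))]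
  rw [Measure.prod_restrict, Measure.prod_restrict, Measure.restrict_apply']
  exact measurableSet_Ioc.prod (MeasurableSet.univ.prod measurableSet_Ioi)

/-- The measure of the region whose `z`-slice is an interval of length `T z` times a ball of radius
`ρ z`. -/
theorem prod_measure_cylinder_le {E : Type*} [NormedAddCommGroup E] [MeasurableSpace E]
    [BorelSpace E] [SecondCountableTopology E] (ν : Measure E) [SFinite ν]
    (μ : Measure ℝ) [SFinite μ]
    {T ρ : ℝ → ℝ} (hT : Measurable T) (hρ : Measurable ρ) {A : Set ℝ} (hA : MeasurableSet A) :
    ((volume : Measure ℝ).prod (ν.prod μ))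
        {q : ℝ × E × ℝ | q.1 ∈ Ioc 0 (T q.2.2) ∧ ‖q.2.1‖ ≤ ρ q.2.2 ∧ q.2.2 ∈ A}
      ≤ ∫⁻ z in A, ENNReal.ofReal (T z) * ν (Metric.closedBall 0 (ρ z)) ∂μ := by
  have hS : MeasurableSet
      {q : ℝ × E × ℝ | q.1 ∈ Ioc 0 (T q.2.2) ∧ ‖q.2.1‖ ≤ ρ q.2.2 ∧ q.2.2 ∈ A} := by
    refine MeasurableSet.inter (MeasurableSet.inter ?_ ?_) (MeasurableSet.inter ?_ ?_)
    · exact measurableSet_lt measurable_const measurable_fst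
    · exact measurableSet_le measurable_fst (hT.comp (measurable_snd.comp measurable_snd))
    · exact measurableSet_le (measurable_norm.comp (measurable_fst.comp measurable_snd))
        (hρ.comp (measurable_snd.comp measurable_snd))
    · exact (measurable_snd.comp measurable_snd) hA
  have hball : Measurable fun z => ν (Metric.closedBall 0 (ρ z)) := by
    have hB : MeasurableSet {q : E × ℝ | ‖q.1‖ ≤ ρ q.2} :=
      measurableSet_le (measurable_norm.comp measurable_fst) (hρ.comp measurable_snd)
    convert measurable_measure_prodMk_right (μ := ν) hB using 3 with z
    ext y
    simp
  have hI : MeasurableSet {w : ℝ × ℝ | w.1 ∈ Ioc 0 (T w.2)} :=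
    (measurableSet_lt measurable_const measurable_fst).inter
      (measurableSet_le measurable_fst (hT.comp measurable_snd))
  have hmeas : Measurable fun w : ℝ × ℝ =>
      ({w : ℝ × ℝ | w.1 ∈ Ioc 0 (T w.2)}.indicator 1 w : ℝ≥0∞)
        * ν (Metric.closedBall 0 (ρ w.2)) :=
    (measurable_one.indicator hI).mul (hball.comp measurable_snd)
  rw [Measure.prod_apply hS]
  calc ∫⁻ s, (ν.prod μ) (Prod.mk s ⁻¹'
          {q : ℝ × E × ℝ | q.1 ∈ Ioc 0 (T q.2.2) ∧ ‖q.2.1‖ ≤ ρ q.2.2 ∧ q.2.2 ∈ A})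
      ≤ ∫⁻ s, ∫⁻ z in A, ({w : ℝ × ℝ | w.1 ∈ Ioc 0 (T w.2)}.indicator 1 (s, z) : ℝ≥0∞)
          * ν (Metric.closedBall 0 (ρ z)) ∂μ := by
        refine lintegral_mono fun s => ?_
        simp only
        rw [Measure.prod_apply_symm (measurable_prodMk_left hS), ← lintegral_indicator hA]
        refine lintegral_mono fun z => ?_
        by_cases hz : z ∈ A
        · by_cases hs : s ∈ Ioc 0 (T z)
          · rw [indicator_of_mem hz, indicator_of_mem (by exact hs), Pi.one_apply, one_mul]
            refine measure_mono fun y hy => ?_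
            simpa using hy.2.1
          · refine le_of_eq_of_le ?_ zero_le
            rw [show (fun y : E => (y, z)) ⁻¹' (Prod.mk s ⁻¹' _) = (∅ : Set E) from
              eq_empty_of_forall_notMem fun y hy => hs hy.1, measure_empty]
        · refine le_of_eq_of_le ?_ zero_le
          rw [show (fun y : E => (y, z)) ⁻¹' (Prod.mk s ⁻¹' _) = (∅ : Set E) from
            eq_empty_of_forall_notMem fun y hy => hz hy.2.2, measure_empty]
    _ = ∫⁻ z in A, (∫⁻ s, ({w : ℝ × ℝ | w.1 ∈ Ioc 0 (T w.2)}.indicator 1 (s, z) : ℝ≥0∞)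
          * ν (Metric.closedBall 0 (ρ z))) ∂μ :=
        lintegral_lintegral_swap hmeas.aemeasurable
    _ = ∫⁻ z in A, ENNReal.ofReal (T z) * ν (Metric.closedBall 0 (ρ z)) ∂μ := by
        refine lintegral_congr fun z => ?_
        have hz : Measurable fun s : ℝ =>
            ({w : ℝ × ℝ | w.1 ∈ Ioc 0 (T w.2)}.indicator 1 (s, z) : ℝ≥0∞) :=
          (measurable_one.indicator hI).comp measurable_prodMk_right
        rw [lintegral_mul_const _ hz]
        congr 1
        calc ∫⁻ s, ({w : ℝ × ℝ | w.1 ∈ Ioc 0 (T w.2)}.indicator 1 (s, z) : ℝ≥0∞)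
            = ∫⁻ s, (Ioc 0 (T z)).indicator 1 s := rfl
          _ = ENNReal.ofReal (T z) := by
            rw [lintegral_indicator_one measurableSet_Ioc, Real.volume_Ioc, sub_zero]

/-- Bound of `etaBar` by the truncated and the tail moments of `lam`. -/
theorem exists_etaBar_le {d : ℕ} (hd : 1 ≤ d) {α t : ℝ} (hα : 0 < α) (ht : 0 < t)
    (lam : Measure ℝ) [SFinite lam] {g : ℝ → ℝ} (hg_anti : AntitoneOn g (Ici 0))
    (hg0 : 0 < g 0) {K : ℝ} (hK : 0 < K)
    (hgK : ∀ x, 0 ≤ x → x ^ ((d : ℝ) + α) * g x ≤ K) :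
    ∃ B : ℝ, 0 < B ∧ ∀ r : ℝ, 0 < r → etaBar d α t g lam r ≤
      ENNReal.ofReal (B * r ^ (-(1 + α / (d : ℝ))))
          * ∫⁻ z in Ioc 0 r, ENNReal.ofReal (z ^ (1 + α / (d : ℝ))) ∂lam
        + ENNReal.ofReal (B * r ^ (-((d : ℝ) / ((d : ℝ) + α))))
          * ∫⁻ z in Ioi r, ENNReal.ofReal (z ^ ((d : ℝ) / ((d : ℝ) + α))) ∂lam := by
  have hd0 : (0 : ℝ) < d := by exact_mod_cast hd
  have hda : 0 < (d : ℝ) + α := by positivity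
  set θ : ℝ := (d : ℝ) / ((d : ℝ) + α) with hθ
  set p : ℝ := 1 + α / (d : ℝ) with hp
  have hθ0 : 0 < θ := by positivity
  have hexp : α / d + α / d * θ + θ = p := by
    rw [hθ, hp]; field_simp; ring
  set ν : Measure (EuclideanSpace ℝ (Fin d)) := volume with hν
  set v : ℝ := (ν (Metric.ball 0 1)).toReal with hv
  have hvtop : ν (Metric.ball 0 1) ≠ ⊤ := measure_ball_lt_top.ne
  have hv0 : 0 < v := ENNReal.toReal_pos (Metric.measure_ball_pos ν 0 one_pos).ne' hvtop
  set G : ℝ := g 0 ^ (α / d) with hG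
  have hG0 : 0 < G := Real.rpow_pos_of_pos hg0 _
  set B : ℝ := v * K ^ θ * (t * t ^ θ + G * G ^ θ) with hB
  have hB0 : 0 < B := by positivity
  refine ⟨B, hB0, fun r hr => ?_⟩
  set T : ℝ → ℝ := fun z => min t ((g 0 * (z / r)) ^ (α / d)) with hT
  set ρ : ℝ → ℝ := fun z => (K * T z * (z / r)) ^ (1 / ((d : ℝ) + α)) with hρ
  have hTm : Measurable T := by fun_prop
  have hρm : Measurable ρ := by fun_prop
  have hT0 : ∀ z, 0 < z → 0 < T z := fun z hz => lt_min ht (by positivity)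
  have hsub : {q : ℝ × EuclideanSpace ℝ (Fin d) × ℝ | r < pker d α g q.1 q.2.1 * q.2.2} ∩
      Ioc 0 t ×ˢ (univ ×ˢ Ioi 0) ⊆
      {q | q.1 ∈ Ioc 0 (T q.2.2) ∧ ‖q.2.1‖ ≤ ρ q.2.2 ∧ q.2.2 ∈ Ioi (0 : ℝ)} := by
    rintro ⟨s, y, z⟩ ⟨hr1, ⟨hs0, hst⟩, -, hz⟩
    simp only [mem_ofPred_eq, mem_Ioi, mem_Ioc, pker] at hr1 hs0 hst hz ⊢
    set x : ℝ := ‖y‖ / s ^ (1 / α) with hx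
    have hx0 : 0 ≤ x := by positivity
    have hsd : 0 < s ^ ((d : ℝ) / α) := by positivity
    have hr2 : s ^ ((d : ℝ) / α) * r < g x * z := by
      rw [Real.rpow_neg hs0.le, mul_assoc, ← div_eq_inv_mul, lt_div_iff₀ hsd] at hr1
      linarith
    have hgx : g x ≤ g 0 := hg_anti (mem_Ici.2 le_rfl) (mem_Ici.2 hx0) hx0
    have hsT : s ≤ T z := by
      refine le_min hst ?_
      have h1 : s ^ ((d : ℝ) / α) ≤ g 0 * (z / r) := by
        rw [← mul_div_assoc, le_div_iff₀ hr]
        exact hr2.le.trans (by gcongr)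
      calc s = (s ^ ((d : ℝ) / α)) ^ (α / d) := by
            rw [← Real.rpow_mul hs0.le, div_mul_div_comm, mul_comm (d : ℝ) α,
              div_self (by positivity), Real.rpow_one]
        _ ≤ _ := by gcongr
    refine ⟨⟨hs0, hsT⟩, ?_, hz⟩
    have hy : ‖y‖ ^ ((d : ℝ) + α) ≤ K * T z * (z / r) := by
      have hyx : ‖y‖ = x * s ^ (1 / α) := by rw [hx]; field_simp
      have hpow : ‖y‖ ^ ((d : ℝ) + α) = x ^ ((d : ℝ) + α) * (s ^ ((d : ℝ) / α) * s) := by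
        rw [hyx, Real.mul_rpow hx0 (by positivity), ← Real.rpow_mul hs0.le,
          ← Real.rpow_add_one hs0.ne']
        congr 2
        field_simp
      rw [← mul_div_assoc, le_div_iff₀ hr, hpow]
      calc x ^ ((d : ℝ) + α) * (s ^ ((d : ℝ) / α) * s) * r
          = x ^ ((d : ℝ) + α) * (s ^ ((d : ℝ) / α) * r) * s := by ring
        _ ≤ x ^ ((d : ℝ) + α) * (g x * z) * s := by gcongr
        _ = x ^ ((d : ℝ) + α) * g x * (s * z) := by ring
        _ ≤ K * (T z * z) := by
          have := hgK x hx0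
          gcongr
        _ = K * T z * z := by ring
    calc ‖y‖ = (‖y‖ ^ ((d : ℝ) + α)) ^ (1 / ((d : ℝ) + α)) := by
          rw [← Real.rpow_mul (norm_nonneg _), mul_one_div_cancel hda.ne', Real.rpow_one]
      _ ≤ _ := by simp only [hρ]; gcongr
  have hint : ∀ z, 0 < z → ENNReal.ofReal (T z) * ν (Metric.closedBall 0 (ρ z)) =
      ENNReal.ofReal (v * K ^ θ * (T z * T z ^ θ * (z / r) ^ θ)) := by
    intro z hz
    have hTz := hT0 z hz
    have hρ0 : 0 ≤ ρ z := by positivity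
    have hρd : ρ z ^ d = K ^ θ * T z ^ θ * (z / r) ^ θ := by
      simp only [hρ]
      rw [← Real.rpow_natCast, ← Real.rpow_mul (by positivity), one_div_mul_eq_div,
        Real.mul_rpow (by positivity) (by positivity), Real.mul_rpow hK.le hTz.le]
    rw [Measure.addHaar_closedBall _ _ hρ0, finrank_euclideanSpace_fin,
      ← ENNReal.ofReal_toReal hvtop, ← ENNReal.ofReal_mul (by positivity),
      ← ENNReal.ofReal_mul hTz.le, hρd]
    congr 1
    ring
  have hscale : ∀ (q z : ℝ), 0 < z → B * (z / r) ^ q = B * r ^ (-q) * z ^ q := by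
    intro q z hz
    rw [Real.div_rpow hz.le hr.le, Real.rpow_neg hr.le]
    field_simp
  have hpt1 : ∀ z, 0 < z → ENNReal.ofReal (T z) * ν (Metric.closedBall 0 (ρ z)) ≤
      ENNReal.ofReal (B * r ^ (-p)) * ENNReal.ofReal (z ^ p) := by
    intro z hz
    have hTz := hT0 z hz
    rw [hint z hz, ← ENNReal.ofReal_mul (by positivity), ← hscale p z hz]
    apply ENNReal.ofReal_le_ofReal
    have hw : 0 < z / r := by positivity
    have h1 : T z ≤ G * (z / r) ^ (α / d) := by
      rw [hG, ← Real.mul_rpow hg0.le hw.le]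
      exact min_le_right _ _
    calc v * K ^ θ * (T z * T z ^ θ * (z / r) ^ θ)
        ≤ v * K ^ θ * (G * (z / r) ^ (α / d) * (G * (z / r) ^ (α / d)) ^ θ * (z / r) ^ θ) := by
          gcongr
      _ = v * K ^ θ * (G * G ^ θ) * (z / r) ^ p := by
          rw [Real.mul_rpow hG0.le (by positivity), ← Real.rpow_mul hw.le, ← hexp,
            Real.rpow_add hw, Real.rpow_add hw]
          ring
      _ ≤ B * (z / r) ^ p := by
          rw [hB]
          gcongr
          have : 0 < t * t ^ θ := by positivity
          linarith
  have hpt2 : ∀ z, 0 < z → ENNReal.ofReal (T z) * ν (Metric.closedBall 0 (ρ z)) ≤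
      ENNReal.ofReal (B * r ^ (-θ)) * ENNReal.ofReal (z ^ θ) := by
    intro z hz
    have hTz := hT0 z hz
    rw [hint z hz, ← ENNReal.ofReal_mul (by positivity), ← hscale θ z hz]
    apply ENNReal.ofReal_le_ofReal
    have h1 : T z ≤ t := min_le_left _ _
    calc v * K ^ θ * (T z * T z ^ θ * (z / r) ^ θ)
        ≤ v * K ^ θ * (t * t ^ θ * (z / r) ^ θ) := by gcongr
      _ = v * K ^ θ * (t * t ^ θ) * (z / r) ^ θ := by ring
      _ ≤ B * (z / r) ^ θ := by
          rw [hB]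
          gcongr
          have : 0 < G * G ^ θ := by positivity
          linarith
  rw [etaBar_eq]
  calc _ ≤ _ := measure_mono hsub
    _ ≤ _ := prod_measure_cylinder_le ν lam hTm hρm measurableSet_Ioi
    _ = ∫⁻ z in Ioc 0 r ∪ Ioi r, ENNReal.ofReal (T z) * ν (Metric.closedBall 0 (ρ z)) ∂lam := by
        rw [Ioc_union_Ioi_eq_Ioi hr.le]
    _ ≤ _ := lintegral_union_le _ _ _
    _ ≤ (∫⁻ z in Ioc 0 r, ENNReal.ofReal (B * r ^ (-p)) * ENNReal.ofReal (z ^ p) ∂lam)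
          + ∫⁻ z in Ioi r, ENNReal.ofReal (B * r ^ (-θ)) * ENNReal.ofReal (z ^ θ) ∂lam :=
        add_le_add
          (setLIntegral_mono (by fun_prop) fun z hz => hpt1 z hz.1)
          (setLIntegral_mono (by fun_prop) fun z hz => hpt2 z (hr.trans hz))
    _ = _ := by
        rw [lintegral_const_mul _ (by fun_prop), lintegral_const_mul _ (by fun_prop)]

/-- `etaBar` dominates a multiple of a rescaled tail of `lam`. -/
theorem exists_le_etaBar (d : ℕ) {α t : ℝ} (hα : 0 < α) (ht : 0 < t)
    (lam : Measure ℝ) [SFinite lam] {g : ℝ → ℝ} (hg_anti : AntitoneOn g (Ici 0))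
    (hg_pos : ∀ x : ℝ, 0 ≤ x → 0 < g x) :
    ∃ m κ : ℝ, 0 < m ∧ 0 < κ ∧ ∀ r : ℝ, 0 < r →
      ENNReal.ofReal κ * lam (Ioi (m * r)) ≤ etaBar d α t g lam r := by
  set ν : Measure (EuclideanSpace ℝ (Fin d)) := volume with hν
  have hvtop : ν (Metric.closedBall 0 1) ≠ ⊤ := measure_closedBall_lt_top.ne
  have hv0 : 0 < (ν (Metric.closedBall 0 1)).toReal :=
    ENNReal.toReal_pos (Metric.measure_closedBall_pos ν 0 one_pos).ne' hvtop
  set X : ℝ := 1 / (t / 2) ^ (1 / α) with hX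
  have hX0 : 0 ≤ X := by positivity
  have hgX := hg_pos X hX0
  set M : ℝ := t ^ (-((d : ℝ) / α)) * g X with hM
  have hM0 : 0 < M := by positivity
  refine ⟨M⁻¹, t / 2 * (ν (Metric.closedBall 0 1)).toReal, by positivity, by positivity,
    fun r hr => ?_⟩
  rw [etaBar_eq]
  have hsub : Ioc (t / 2) t ×ˢ
        (Metric.closedBall (0 : EuclideanSpace ℝ (Fin d)) 1 ×ˢ Ioi (M⁻¹ * r)) ⊆
      {q : ℝ × EuclideanSpace ℝ (Fin d) × ℝ | r < pker d α g q.1 q.2.1 * q.2.2} ∩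
        Ioc 0 t ×ˢ (univ ×ˢ Ioi 0) := by
    rintro ⟨s, y, z⟩ ⟨⟨hs1, hs2⟩, hy, hz⟩
    simp only [mem_closedBall_zero_iff, mem_Ioi] at hs1 hs2 hy hz
    have hs0 : 0 < s := by linarith
    have hz0 : 0 < z := lt_trans (by positivity) hz
    refine ⟨?_, ⟨hs0, hs2⟩, mem_univ _, hz0⟩
    have hx : ‖y‖ / s ^ (1 / α) ≤ X := by
      rw [hX]
      gcongr
    have hg1 : g X ≤ g (‖y‖ / s ^ (1 / α)) :=
      hg_anti (mem_Ici.2 (by positivity)) (mem_Ici.2 hX0) hx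
    have hs3 : t ^ (-((d : ℝ) / α)) ≤ s ^ (-((d : ℝ) / α)) :=
      Real.rpow_le_rpow_of_nonpos hs0 hs2 (neg_nonpos.2 (by positivity))
    calc r < M * z := by rwa [inv_mul_lt_iff₀ hM0] at hz
      _ ≤ pker d α g s y * z := by
        rw [hM, pker]
        gcongr
  refine le_trans (le_of_eq ?_) (measure_mono hsub)
  rw [Measure.prod_prod, Measure.prod_prod, Real.volume_Ioc, sub_half,
    ENNReal.ofReal_mul (by positivity), ENNReal.ofReal_toReal hvtop, mul_assoc]

theorem stmt8 (d : ℕ) (hd : 1 ≤ d) (α : ℝ) (hα : α ∈ Set.Ioo (0:ℝ) 2) (t : ℝ) (ht : 0 < t)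
    (lam : MeasureTheory.Measure ℝ) [SigmaFinite lam]
    (hlam0 : lam (Set.Iic 0) = 0) (hlam_ne : lam ≠ 0)
    (hmom : ∫⁻ z in Set.Ioi (0:ℝ), ENNReal.ofReal (min 1 (z ^ 2)) ∂lam ≠ ⊤)
    (g : ℝ → ℝ) (hg_cont : ContinuousOn g (Set.Ici 0))
    (hg_anti : StrictAntiOn g (Set.Ici 0)) (hg_pos : ∀ x : ℝ, 0 ≤ x → 0 < g x)
    (c₀ : ℝ) (hc₀ : 0 < c₀)
    (hg_tail : Filter.Tendsto (fun r : ℝ => r ^ ((d:ℝ) + α) * g r) Filter.atTop (nhds c₀))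
    (hsmall : ∫⁻ z in Set.Ioc (0:ℝ) 1, ENNReal.ofReal (z ^ (1 + α / (d:ℝ))) ∂lam ≠ ⊤)
    (hbig : ∫⁻ z in Set.Ioi (1:ℝ), ENNReal.ofReal (z ^ ((d:ℝ) / ((d:ℝ) + α))) ∂lam ≠ ⊤)
    (β : ℝ) (hβ1 : (d:ℝ) / ((d:ℝ) + α) < β) (hβ2 : β < 1 + α / (d:ℝ))
    (l : ℝ → ℝ) (hl : SlowlyVarying l) (hl_pos : ∀ x : ℝ, 0 < x → 0 < l x)
    (hlaml : ∃ C : ℝ, 1 ≤ C ∧ ∀ r : ℝ, 1 ≤ r →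
      C⁻¹ * (l r / r ^ β) ≤ (lam (Set.Ioi r)).toReal ∧
      (lam (Set.Ioi r)).toReal ≤ C * (l r / r ^ β)) :
    ∃ C : ℝ, 1 ≤ C ∧ ∀ᶠ r : ℝ in Filter.atTop,
      C⁻¹ * (lam (Set.Ioi r)).toReal ≤ (etaBar d α t g lam r).toReal ∧
      (etaBar d α t g lam r).toReal ≤ C * (lam (Set.Ioi r)).toReal := by

  obtain ⟨C, hC, hF⟩ := hlaml
  have hd0 : (0 : ℝ) < d := by exact_mod_cast hd
  have hα0 : 0 < α := hα.1
  set θ : ℝ := (d : ℝ) / ((d : ℝ) + α) with hθ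
  set p : ℝ := 1 + α / (d : ℝ) with hp
  have hθ0 : 0 < θ := by positivity
  have hp0 : 0 < p := by positivity
  have hpos : ∀ r : ℝ, 1 ≤ r → 0 < (lam (Ioi r)).toReal := fun r hr => by
    have hr0 : 0 < r := by linarith
    have := hl_pos r hr0
    refine lt_of_lt_of_le ?_ (hF r hr).1
    positivity
  have hfin : ∀ r : ℝ, 1 ≤ r → lam (Ioi r) ≠ ⊤ := fun r hr h => by
    have := hpos r hr
    simp [h] at this
  have hg_anti' := hg_anti.antitoneOn
  have hg0 := hg_pos 0 le_rfl
  obtain ⟨K, hK, hgK⟩ := exists_rpow_mul_le_of_tendsto hg_anti' hg0.le (by positivity) hg_tail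
  obtain ⟨B, hB, hup⟩ := exists_etaBar_le hd hα0 ht lam hg_anti' hg0 hK hgK
  obtain ⟨m, κ, hm, hκ, hlow⟩ := exists_le_etaBar d hα0 ht lam hg_anti' hg_pos
  set F : ℝ → ℝ := fun r => (lam (Ioi r)).toReal with hFdef
  have hscal := fun {c : ℝ} (hc : 0 < c) => hl.eventually_scaling (F := F) hl_pos hC hF hc
  set D : ℝ := 2 * C ^ 2 with hD
  have hD0 : 0 < D := by positivity
  obtain ⟨c, hc1, hcθ, hcp⟩ : ∃ c : ℝ, 1 < c ∧ D * c ^ (-β) * c ^ θ < 1 ∧ D * c ^ β < c ^ p := by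
    have e1 := (tendsto_rpow_atTop (sub_pos.2 hβ1)).eventually_gt_atTop D
    have e2 := (tendsto_rpow_atTop (sub_pos.2 hβ2)).eventually_gt_atTop D
    obtain ⟨c, h1, h2, hc⟩ := (e1.and (e2.and (eventually_gt_atTop 1))).exists
    have hc0 : 0 < c := by linarith
    refine ⟨c, hc, ?_, ?_⟩
    · rw [Real.rpow_sub hc0, lt_div_iff₀ (by positivity)] at h1
      rw [Real.rpow_neg hc0.le, mul_assoc, mul_left_comm, inv_mul_lt_iff₀ (by positivity)]
      linarith
    · rwa [Real.rpow_sub hc0, lt_div_iff₀ (by positivity)] at h2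
  have hc0 : 0 < c := by linarith
  obtain ⟨R₀, hR₀⟩ := eventually_atTop.1 (hscal hc0)
  set R : ℝ := max R₀ 1 with hRdef
  have hR1 : 1 ≤ R := le_max_right _ _
  have hR0 : 0 < R := by linarith
  have hRsc := fun r (hr : R ≤ r) => hR₀ r ((le_max_left _ _).trans hr)
  obtain ⟨M₁, hM₁, htail⟩ := exists_setLIntegral_Ioi_rpow_le lam hc1 hR0 hθ0.le
    hcθ (fun r hr => hfin r (hR1.trans hr)) (fun r hr => (hRsc r hr).1)
  have hmomR : ∫⁻ z in Ioc 0 (c * R), ENNReal.ofReal (z ^ p) ∂lam ≠ ⊤ := by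
    have h1 := setLIntegral_Ioc_rpow_le lam (b := c * R) zero_le_one hp0.le (hfin 1 le_rfl)
    refine ne_top_of_le_ne_top (ENNReal.add_ne_top.2 ⟨hsmall, ne_top_of_le_ne_top
      ENNReal.ofReal_ne_top h1⟩) ((lintegral_mono_set ?_).trans (lintegral_union_le _ _ _))
    exact Ioc_subset_Ioc_union_Ioc
  obtain ⟨M₂, hM₂, htrunc⟩ := exists_setLIntegral_Ioc_rpow_le lam hc1 hR0 hp0.le
    (by positivity) hcp (fun r hr => hfin r (hR1.trans hr)) (fun r hr => hpos r (hR1.trans hr))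
    hmomR (fun r hr => (hRsc r hr).2)
  have hupper : ∀ r, R ≤ r →
      etaBar d α t g lam r ≤ ENNReal.ofReal (B * (M₂ + M₁) * F r) := by
    intro r hr
    have hr0 : 0 < r := hR0.trans_le hr
    have hF0 : 0 < F r := hpos r (hR1.trans hr)
    have hcancel : ∀ q : ℝ, r ^ (-q) * r ^ q = 1 := fun q => by
      rw [← Real.rpow_add hr0, neg_add_cancel, Real.rpow_zero]
    calc etaBar d α t g lam r
        ≤ _ := hup r hr0
      _ ≤ ENNReal.ofReal (B * r ^ (-p)) * ENNReal.ofReal (M₂ * (r ^ p * F r))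
          + ENNReal.ofReal (B * r ^ (-θ)) * ENNReal.ofReal (M₁ * (r ^ θ * F r)) := by
          gcongr
          · exact htrunc r hr
          · exact htail r hr
      _ = ENNReal.ofReal (B * r ^ (-p) * (M₂ * (r ^ p * F r))
            + B * r ^ (-θ) * (M₁ * (r ^ θ * F r))) := by
          rw [← ENNReal.ofReal_mul (by positivity), ← ENNReal.ofReal_mul (by positivity),
            ENNReal.ofReal_add (by positivity) (by positivity)]
      _ = _ := by
          congr 1
          linear_combination B * M₂ * F r * hcancel p + B * M₁ * F r * hcancel θ
  set E : ℝ := D * m ^ β with hE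
  have hE0 : 0 < E := by positivity
  refine ⟨max 1 (max (B * (M₂ + M₁)) (E / κ)), le_max_left _ _, ?_⟩
  set Q : ℝ := max 1 (max (B * (M₂ + M₁)) (E / κ)) with hQ
  have hQ1 : 1 ≤ Q := le_max_left _ _
  have hQ2 : B * (M₂ + M₁) ≤ Q := (le_max_left _ _).trans (le_max_right _ _)
  have hQ3 : E / κ ≤ Q := (le_max_right _ _).trans (le_max_right _ _)
  filter_upwards [hscal hm, eventually_ge_atTop R] with r hrm hr
  have hr0 : 0 < r := hR0.trans_le hr
  have hF0 : 0 < F r := hpos r (hR1.trans hr)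
  have hηfin : etaBar d α t g lam r ≠ ⊤ := ne_top_of_le_ne_top ENNReal.ofReal_ne_top (hupper r hr)
  constructor
  · have h1 := ENNReal.toReal_mono hηfin (hlow r hr0)
    rw [ENNReal.toReal_mul, ENNReal.toReal_ofReal hκ.le] at h1
    rw [inv_mul_le_iff₀ (by linarith)]
    calc F r ≤ E * F (m * r) := hrm.2
      _ = E / κ * (κ * F (m * r)) := by field_simp
      _ ≤ Q * (etaBar d α t g lam r).toReal := by gcongr
  · calc (etaBar d α t g lam r).toReal ≤ B * (M₂ + M₁) * F r :=
          ENNReal.toReal_le_of_le_ofReal (by positivity) (hupper r hr)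
      _ ≤ Q * F r := by gcongr
end
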